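/- arXiv:1512.08487 — 10 statements merged into one kernel-verified Lean document; each statement's English description precedes it below -/
import Mathlib

section
/- Let p > 1 and let W(u) = -(u+1)^2/2 + (1+u)^{p+1}/(p+1) + (p-1)/(2(p+1)) for u > -1. Then the function C(u) = d/du [ W(u) / W'(u)^2 ] is strictly increasing on (-1, 0) and on (0, ∞), and in fact strictly increasing across u = 0 on all of (-1, ∞) \ {0} (where W'(0) = 0 excludes u = 0 from the domain). -/
open Set Filter Topology

/-- A function vanishing at `0` whose derivative has the sign of the variable between `0` and `u`
is positive at `u`. -/
theorem pos_of_hasDerivAt_of_mul_pos {f f' : ℝ → ℝ} {u : ℝ} (hu : u ≠ 0) (h0 : f 0 = 0)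
    (hd : ∀ v ∈ uIcc 0 u, HasDerivAt f (f' v) v)
    (hs : ∀ v ∈ uIcc 0 u, v ≠ 0 → 0 < v * f' v) : 0 < f u := by
  rcases hu.lt_or_gt with h | h
  · rw [uIcc_of_ge h.le] at hd hs
    obtain ⟨c, hc, hce⟩ := exists_hasDerivAt_eq_slope f f' h
      (fun v hv => (hd v hv).continuousAt.continuousWithinAt)
      (fun v hv => hd v (Ioo_subset_Icc_self hv))
    have hc' := hs c (Ioo_subset_Icc_self hc) hc.2.ne
    have hneg : f' c < 0 := by nlinarith [hc.2]
    rw [hce, h0, div_lt_iff₀ (by linarith)] at hneg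
    linarith
  · rw [uIcc_of_le h.le] at hd hs
    obtain ⟨c, hc, hce⟩ := exists_hasDerivAt_eq_slope f f' h
      (fun v hv => (hd v hv).continuousAt.continuousWithinAt)
      (fun v hv => hd v (Ioo_subset_Icc_self hv))
    have hc' := hs c (Ioo_subset_Icc_self hc) hc.1.ne'
    have hpos : 0 < f' c := by nlinarith [hc.1]
    rw [hce, h0, lt_div_iff₀ (by linarith)] at hpos
    linarith

/-- `(W / W'^2)' = (W'^2 - 2 W W'') / W'^3`. -/
theorem hasDerivAt_div_deriv_sq {W W₁ W₂ : ℝ → ℝ} {u : ℝ} (h₀ : HasDerivAt W (W₁ u) u)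
    (h₁ : HasDerivAt W₁ (W₂ u) u) (hne : W₁ u ≠ 0) :
    HasDerivAt (fun v => W v / W₁ v ^ 2) ((W₁ u ^ 2 - 2 * W u * W₂ u) / W₁ u ^ 3) u := by
  refine (h₀.fun_div (h₁.fun_pow 2) (pow_ne_zero 2 hne)).congr_deriv ?_
  field_simp
  ring

/-- The value at a nondegenerate critical point of the continuous extension of `(W / W'^2)'`. -/
theorem tendsto_chicone_function {W W₁ W₂ W₃ : ℝ → ℝ} {a : ℝ}
    (h₀ : ∀ᶠ u in 𝓝 a, HasDerivAt W (W₁ u) u) (h₁ : ∀ᶠ u in 𝓝 a, HasDerivAt W₁ (W₂ u) u)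
    (h₂ : ∀ᶠ u in 𝓝 a, HasDerivAt W₂ (W₃ u) u) (hc : ContinuousAt W₃ a)
    (hW : W a = 0) (hW₁ : W₁ a = 0) (hW₂ : W₂ a ≠ 0) (hne : ∀ᶠ u in 𝓝[≠] a, W₁ u ≠ 0) :
    Tendsto (fun u => (W₁ u ^ 2 - 2 * W u * W₂ u) / W₁ u ^ 3) (𝓝[≠] a)
      (𝓝 (-(2 * W₃ a / (3 * W₂ a)) * (1 / (2 * W₂ a)))) := by
  have c₀ : ContinuousAt W a := h₀.self_of_nhds.continuousAt
  have c₁ : ContinuousAt W₁ a := h₁.self_of_nhds.continuousAt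
  have c₂ : ContinuousAt W₂ a := h₂.self_of_nhds.continuousAt
  have hne₂ : ∀ᶠ u in 𝓝[≠] a, W₂ u ≠ 0 :=
    (c₂.eventually_ne hW₂).filter_mono nhdsWithin_le_nhds
  replace h₀ := h₀.filter_mono (nhdsWithin_le_nhds (s := {a}ᶜ))
  replace h₁ := h₁.filter_mono (nhdsWithin_le_nhds (s := {a}ᶜ))
  replace h₂ := h₂.filter_mono (nhdsWithin_le_nhds (s := {a}ᶜ))
  have hquot : Tendsto (fun u => W u / W₁ u ^ 2) (𝓝[≠] a) (𝓝 (1 / (2 * W₂ a))) := by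
    refine HasDerivAt.lhopital_zero_nhdsNE (f' := W₁) (g' := fun u => 2 * W₁ u * W₂ u)
      h₀ ?_ ?_ ?_ ?_ ?_
    · filter_upwards [h₁] with u hu
      simpa using hu.fun_pow 2
    · filter_upwards [hne, hne₂] with u hu hu₂
      positivity
    · simpa [hW] using c₀.tendsto.mono_left (nhdsWithin_le_nhds (s := {a}ᶜ))
    · simpa [hW₁] using (c₁.fun_pow 2).tendsto.mono_left (nhdsWithin_le_nhds (s := {a}ᶜ))
    · have hlim : ContinuousAt (fun u => 1 / (2 * W₂ u)) a :=
        continuousAt_const.div (continuousAt_const.mul c₂) (by positivity)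
      refine (hlim.tendsto.mono_left nhdsWithin_le_nhds).congr' ?_
      filter_upwards [hne, hne₂] with u hu hu₂
      field_simp
  refine HasDerivAt.lhopital_zero_nhdsNE (f' := fun u => -2 * W u * W₃ u)
    (g' := fun u => 3 * W₁ u ^ 2 * W₂ u) ?_ ?_ ?_ ?_ ?_ ?_
  · filter_upwards [h₀, h₁, h₂] with u hu hu₁ hu₂
    refine ((hu₁.fun_pow 2).fun_sub ((hu.const_mul 2).fun_mul hu₂)).congr_deriv ?_
    ring
  · filter_upwards [h₁] with u hu
    simpa using hu.fun_pow 3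
  · filter_upwards [hne, hne₂] with u hu hu₂
    positivity
  · have hlim := ((c₁.fun_pow 2).fun_sub ((c₀.const_mul 2).fun_mul c₂)).tendsto
    simpa [hW, hW₁] using hlim.mono_left (nhdsWithin_le_nhds (s := {a}ᶜ))
  · simpa [hW₁] using (c₁.fun_pow 3).tendsto.mono_left (nhdsWithin_le_nhds (s := {a}ᶜ))
  · have hlim : ContinuousAt (fun u => -(2 * W₃ u / (3 * W₂ u))) a :=
      ((continuousAt_const.mul hc).div (continuousAt_const.mul c₂)
        (mul_ne_zero three_ne_zero hW₂)).neg
    refine ((hlim.tendsto.mono_left nhdsWithin_le_nhds).mul hquot).congr' ?_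
    filter_upwards [hne, hne₂] with u hu hu₂
    field_simp

/-- Chicone's criterion in differential form, across a nondegenerate critical point at `0`. -/
theorem strictMonoOn_chicone_function {W W₁ W₂ W₃ : ℝ → ℝ} {a : ℝ} (ha : a < 0)
    (h₀ : ∀ u, a < u → HasDerivAt W (W₁ u) u) (h₁ : ∀ u, a < u → HasDerivAt W₁ (W₂ u) u)
    (h₂ : ∀ u, a < u → HasDerivAt W₂ (W₃ u) u) (hc : ContinuousAt W₃ 0)
    (hW : W 0 = 0) (hW₁ : W₁ 0 = 0) (hW₂ : W₂ 0 ≠ 0) (hne : ∀ u, a < u → u ≠ 0 → W₁ u ≠ 0)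
    (hpos : ∀ u, a < u → u ≠ 0 →
      0 < 6 * W u * W₂ u ^ 2 - 3 * W₁ u ^ 2 * W₂ u - 2 * W u * W₁ u * W₃ u) :
    StrictMonoOn (fun u => (W₁ u ^ 2 - 2 * W u * W₂ u) / W₁ u ^ 3) (Ioi a \ {0}) := by
  set F : ℝ → ℝ := fun u => (W₁ u ^ 2 - 2 * W u * W₂ u) / W₁ u ^ 3
  have hlim := tendsto_chicone_function ((eventually_gt_nhds ha).mono h₀)
    ((eventually_gt_nhds ha).mono h₁) ((eventually_gt_nhds ha).mono h₂) hc hW hW₁ hW₂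
    (by
      filter_upwards [(eventually_gt_nhds ha).filter_mono nhdsWithin_le_nhds,
        self_mem_nhdsWithin] with u hu hu0 using hne u hu hu0)
  set L := -(2 * W₃ 0 / (3 * W₂ 0)) * (1 / (2 * W₂ 0))
  have hderiv : ∀ u, a < u → u ≠ 0 → HasDerivAt F
      ((6 * W u * W₂ u ^ 2 - 3 * W₁ u ^ 2 * W₂ u - 2 * W u * W₁ u * W₃ u) / W₁ u ^ 4) u := by
    intro u hu hu0
    have hu1 := hne u hu hu0
    refine ((((h₁ u hu).fun_pow 2).fun_sub
      (((h₀ u hu).const_mul 2).fun_mul (h₂ u hu))).fun_div ((h₁ u hu).fun_pow 3)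
      (pow_ne_zero 3 hu1)).congr_deriv ?_
    field_simp
    ring
  set E := Function.update F 0 L
  have hE : ∀ u, u ≠ 0 → E u = F u := fun u hu => Function.update_of_ne hu _ _
  have hEderiv : ∀ u, a < u → u ≠ 0 → 0 < deriv E u := by
    intro u hu hu0
    have heq : E =ᶠ[𝓝 u] F := by
      filter_upwards [isOpen_ne.mem_nhds hu0] with v hv using hE v hv
    rw [heq.deriv_eq, (hderiv u hu hu0).deriv]
    have hu1 := hne u hu hu0
    have := hpos u hu hu0
    positivity
  have hEcont : ContinuousOn E (Ioi a) := by
    refine continuousOn_update_iff.2 ⟨fun u hu => ?_, fun _ => ?_⟩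
    · exact (hderiv u hu.1 hu.2).continuousAt.continuousWithinAt
    · exact hlim.mono_left (nhdsWithin_mono _ fun u hu => hu.2)
  have hleft : StrictMonoOn E (Ioc a 0) := by
    refine strictMonoOn_of_deriv_pos (convex_Ioc a 0) (hEcont.mono fun u hu => hu.1) ?_
    rw [interior_Ioc]
    exact fun u hu => hEderiv u hu.1 hu.2.ne
  have hright : StrictMonoOn E (Ici 0) := by
    refine strictMonoOn_of_deriv_pos (convex_Ici 0) (hEcont.mono fun u hu => ha.trans_le hu) ?_
    rw [interior_Ici]
    exact fun u hu => hEderiv u (ha.trans hu) (ne_of_gt hu)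
  have hall := hleft.union hright (isGreatest_Ioc ha) isLeast_Ici
  rw [Ioc_union_Ici_eq_Ioi ha] at hall
  exact (hall.mono sdiff_subset).congr fun u hu => hE u hu.2

section Potential

variable {p u : ℝ}

theorem hasDerivAt_one_add_rpow_sub_one (hu : -1 < u) :
    HasDerivAt (fun v : ℝ => (1 + v) ^ (p - 1)) ((p - 1) * (1 + u) ^ (p - 1) / (1 + u)) u := by
  have hx : 0 < 1 + u := by linarith
  refine (((hasDerivAt_id' u).const_add 1).rpow_const (Or.inl hx.ne')).congr_deriv ?_
  rw [Real.rpow_sub_one hx.ne' (p - 1)]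
  ring

/-- The sign of `(1 + u) ^ (p - 1) - 1` is that of `u`. -/
theorem mul_one_add_rpow_sub_one_pos (hp : 1 < p) (hu : -1 < u) (hu0 : u ≠ 0) :
    0 < u * ((1 + u) ^ (p - 1) - 1) := by
  rcases hu0.lt_or_gt with h | h
  · have := Real.rpow_lt_one (by linarith : 0 ≤ 1 + u) (by linarith) (by linarith : 0 < p - 1)
    nlinarith
  · have := Real.one_lt_rpow (by linarith : 1 < 1 + u) (by linarith : 0 < p - 1)
    nlinarith

theorem hasDerivAt_potential (hp : 1 < p) (hu : -1 < u) :
    HasDerivAt (fun v : ℝ => -(v + 1) ^ 2 / 2 + (1 + v) ^ (p + 1) / (p + 1)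
      + (p - 1) / (2 * (p + 1))) ((1 + u) * ((1 + u) ^ (p - 1) - 1)) u := by
  have hx : 0 < 1 + u := by linarith
  have hid := hasDerivAt_id' u
  refine (((((hid.add_const 1).fun_pow 2).fun_neg.div_const 2).fun_add
    (((hid.const_add 1).rpow_const (Or.inl hx.ne')).div_const (p + 1))).add_const
    _).congr_deriv ?_
  have hpow : (1 + u) ^ (p + 1 - 1) = (1 + u) * (1 + u) ^ (p - 1) := by
    rw [Real.rpow_sub_one hx.ne' p]
    field_simp
    simp
  have hp1 : p + 1 ≠ 0 := by linarith
  rw [hpow]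
  field_simp
  ring

theorem hasDerivAt_deriv_potential (hu : -1 < u) :
    HasDerivAt (fun v : ℝ => (1 + v) * ((1 + v) ^ (p - 1) - 1)) (p * (1 + u) ^ (p - 1) - 1) u := by
  have hx : 0 < 1 + u := by linarith
  refine (((hasDerivAt_id' u).const_add 1).fun_mul
    ((hasDerivAt_one_add_rpow_sub_one hu).sub_const 1)).congr_deriv ?_
  field_simp
  ring

theorem potential_zero (hp : 1 < p) :
    -((0 : ℝ) + 1) ^ 2 / 2 + (1 + 0) ^ (p + 1) / (p + 1) + (p - 1) / (2 * (p + 1)) = 0 := by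
  have hp1 : p + 1 ≠ 0 := by linarith
  simp only [add_zero, zero_add, Real.one_rpow]
  field_simp
  ring

theorem potential_pos (hp : 1 < p) (hu : -1 < u) (hu0 : u ≠ 0) :
    0 < -(u + 1) ^ 2 / 2 + (1 + u) ^ (p + 1) / (p + 1) + (p - 1) / (2 * (p + 1)) := by
  have hmem : ∀ v ∈ uIcc 0 u, -1 < v := fun v hv =>
    (lt_min (by norm_num) hu).trans_le hv.1
  refine pos_of_hasDerivAt_of_mul_pos (f := fun v : ℝ => -(v + 1) ^ 2 / 2 +
    (1 + v) ^ (p + 1) / (p + 1) + (p - 1) / (2 * (p + 1))) hu0 (potential_zero hp)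
    (fun v hv => hasDerivAt_potential hp (hmem v hv)) fun v hv hv0 => ?_
  have := mul_one_add_rpow_sub_one_pos hp (hmem v hv) hv0
  have hx : 0 < 1 + v := by linarith [hmem v hv]
  nlinarith [mul_pos hx this]

theorem chicone_quadratic_pos (hp : 1 < p) {y : ℝ} (hy : 0 < y) :
    0 < 6 * (p * y - 1) ^ 2 - 2 * p * (p - 1) * y * (y - 1) := by
  rcases le_or_gt 7 p with h | h
  · have h1 : 0 ≤ p * (p - 7) * y := by
      have : 0 ≤ p - 7 := by linarith
      positivity
    have h2 : 0 < p * y ^ 2 * (4 * p + 2) := by positivity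
    nlinarith
  · have ha : 0 < 4 * p ^ 2 + 2 * p := by positivity
    have hdisc : 0 < p * (p - 1) ^ 2 * (12 - p) := by
      have h1 : 0 < p - 1 := by linarith
      have h2 : 0 < 12 - p := by linarith
      positivity
    have hsq : 0 ≤ ((4 * p ^ 2 + 2 * p) * y + (p ^ 2 - 7 * p)) ^ 2 := sq_nonneg _
    refine pos_of_mul_pos_right ?_ ha.le
    nlinarith

/-- The quotient `N / A`, where `N = 6 W W''^2 - 3 W'^2 W'' - 2 W W' W'''` equals
`W A - 3 W'^2 W''`, is positive on the region where `W'' > 0`. -/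
theorem chicone_quotient_pos (hp : 1 < p) (hu : -1 < u) (hu0 : u ≠ 0)
    (hy : 1 < p * (1 + u) ^ (p - 1)) :
    0 < -(u + 1) ^ 2 / 2 + (1 + u) ^ (p + 1) / (p + 1) + (p - 1) / (2 * (p + 1)) -
      3 * ((1 + u) * ((1 + u) ^ (p - 1) - 1)) ^ 2 * (p * (1 + u) ^ (p - 1) - 1) /
        (6 * (p * (1 + u) ^ (p - 1) - 1) ^ 2 -
          2 * p * (p - 1) * (1 + u) ^ (p - 1) * ((1 + u) ^ (p - 1) - 1)) := by
  have hmem : ∀ v ∈ uIcc 0 u, -1 < v := fun v hv =>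
    (lt_min (by norm_num) hu).trans_le hv.1
  have hq : 0 < p - 1 := by linarith
  have hmem' : ∀ v ∈ uIcc 0 u, 1 < p * (1 + v) ^ (p - 1) := by
    intro v hv
    rcases le_or_gt 0 v with h | h
    · have := Real.one_le_rpow (by linarith : 1 ≤ 1 + v) hq.le
      nlinarith
    · have huv : u ≤ v := (min_le_iff.1 hv.1).resolve_left h.not_ge
      have := Real.rpow_le_rpow (by linarith) (by linarith : 1 + u ≤ 1 + v) hq.le
      nlinarith
  refine pos_of_hasDerivAt_of_mul_pos (f := fun v : ℝ => -(v + 1) ^ 2 / 2 +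
      (1 + v) ^ (p + 1) / (p + 1) + (p - 1) / (2 * (p + 1)) -
      3 * ((1 + v) * ((1 + v) ^ (p - 1) - 1)) ^ 2 * (p * (1 + v) ^ (p - 1) - 1) /
        (6 * (p * (1 + v) ^ (p - 1) - 1) ^ 2 -
          2 * p * (p - 1) * (1 + v) ^ (p - 1) * ((1 + v) ^ (p - 1) - 1)))
    (f' := fun v : ℝ => (1 + v) * ((1 + v) ^ (p - 1) - 1) ^ 3 * (1 + v) ^ (p - 1) *
      (p * (p - 1) * ((4 * p ^ 2 + 2 * p) * (1 + v) ^ (p - 1) + 6 * (p - 2))) /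
        (6 * (p * (1 + v) ^ (p - 1) - 1) ^ 2 -
          2 * p * (p - 1) * (1 + v) ^ (p - 1) * ((1 + v) ^ (p - 1) - 1)) ^ 2)
    hu0 ?_ (fun v hv => ?_) (fun v hv hv0 => ?_)
  · simp only [potential_zero hp]
    simp
  · have hx : 0 < 1 + v := by linarith [hmem v hv]
    have hA := chicone_quadratic_pos hp (Real.rpow_pos_of_pos hx (p - 1))
    have hY := hasDerivAt_one_add_rpow_sub_one (p := p) (hmem v hv)
    have hW₂ := (hY.const_mul p).sub_const 1
    refine ((hasDerivAt_potential hp (hmem v hv)).fun_sub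
      (((((hasDerivAt_deriv_potential (p := p) (hmem v hv)).fun_pow 2).const_mul 3).fun_mul
        hW₂).fun_div (((hW₂.fun_pow 2).const_mul 6).fun_sub
          ((hY.const_mul (2 * p * (p - 1))).fun_mul (hY.sub_const 1))) hA.ne')).congr_deriv ?_
    generalize (1 + v) ^ (p - 1) = y at hA
    generalize 1 + v = x at hx
    generalize hAdef : 6 * (p * y - 1) ^ 2 - 2 * p * (p - 1) * y * (y - 1) = A at hA
    field_simp
    rw [← hAdef]
    ring
  · have hx : 0 < 1 + v := by linarith [hmem v hv]
    have hY := Real.rpow_pos_of_pos hx (p - 1)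
    have hA := chicone_quadratic_pos hp hY
    have hs := mul_one_add_rpow_sub_one_pos hp (hmem v hv) hv0
    have hy' := hmem' v hv
    generalize (1 + v) ^ (p - 1) = y at hA hs hy' hY
    have hlin : 0 < (4 * p ^ 2 + 2 * p) * y + 6 * (p - 2) := by nlinarith
    have hy1 : y - 1 ≠ 0 := right_ne_zero_of_mul hs.ne'
    have hsq : 0 < (y - 1) ^ 2 := by positivity
    have : 0 < (v * (y - 1)) * ((1 + v) * (y - 1) ^ 2 * y *
        (p * (p - 1) * ((4 * p ^ 2 + 2 * p) * y + 6 * (p - 2))) /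
        (6 * (p * y - 1) ^ 2 - 2 * p * (p - 1) * y * (y - 1)) ^ 2) := by positivity
    convert this using 1
    ring

theorem chicone_numerator_pos (hp : 1 < p) (hu : -1 < u) (hu0 : u ≠ 0) {w : ℝ}
    (hw : w = -(u + 1) ^ 2 / 2 + (1 + u) ^ (p + 1) / (p + 1) + (p - 1) / (2 * (p + 1))) :
    0 < 6 * w * (p * (1 + u) ^ (p - 1) - 1) ^ 2 -
      3 * ((1 + u) * ((1 + u) ^ (p - 1) - 1)) ^ 2 * (p * (1 + u) ^ (p - 1) - 1) -
      2 * w * ((1 + u) * ((1 + u) ^ (p - 1) - 1)) *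
        (p * ((p - 1) * (1 + u) ^ (p - 1) / (1 + u))) := by
  have hx : 0 < 1 + u := by linarith
  have hY := Real.rpow_pos_of_pos hx (p - 1)
  have hA := chicone_quadratic_pos hp hY
  have hwpos := potential_pos hp hu hu0
  have hquot := chicone_quotient_pos hp hu hu0
  rw [← hw] at hwpos hquot
  generalize (1 + u) ^ (p - 1) = y at hY hA hquot
  set A := 6 * (p * y - 1) ^ 2 - 2 * p * (p - 1) * y * (y - 1) with hAdef
  have hN : 6 * w * (p * y - 1) ^ 2 - 3 * ((1 + u) * (y - 1)) ^ 2 * (p * y - 1) -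
      2 * w * ((1 + u) * (y - 1)) * (p * ((p - 1) * y / (1 + u))) =
      w * A - 3 * ((1 + u) * (y - 1)) ^ 2 * (p * y - 1) := by
    rw [hAdef]
    field_simp
    ring
  rw [hN]
  rcases le_or_gt (p * y) 1 with h | h
  · have h1 : 0 ≤ 3 * ((1 + u) * (y - 1)) ^ 2 * (1 - p * y) :=
      mul_nonneg (by positivity) (by linarith)
    have h2 : 0 < w * A := mul_pos hwpos hA
    linarith
  · have h1 := hquot h
    rw [sub_pos, div_lt_iff₀ hA] at h1
    linarith

end Potential

/-- For `p > 1` and the shifted potential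
`W(u) = -(u+1)^2/2 + (1+u)^(p+1)/(p+1) + (p-1)/(2(p+1))`, the function
`C(u) = d/du [W(u)/W'(u)^2]` is strictly increasing on `(-1, ∞) \ {0}`
(hence in particular on `(-1,0)` and on `(0,∞)`, and across `u = 0`). -/
theorem chicone_function_strictMono
    (p : ℝ) (hp : 1 < p)
    (W : ℝ → ℝ)
    (hW : ∀ u : ℝ, W u = -(u + 1) ^ 2 / 2 + (1 + u) ^ (p + 1) / (p + 1)
      + (p - 1) / (2 * (p + 1)))
    (C : ℝ → ℝ)
    (hC : ∀ u : ℝ, C u = deriv (fun v => W v / (deriv W v) ^ 2) u) :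
    StrictMonoOn C (Set.Ioi (-1 : ℝ) \ {0}) := by
  obtain rfl : W = fun v : ℝ => -(v + 1) ^ 2 / 2 + (1 + v) ^ (p + 1) / (p + 1)
      + (p - 1) / (2 * (p + 1)) := funext hW
  have hne : ∀ u : ℝ, -1 < u → u ≠ 0 → (1 + u) * ((1 + u) ^ (p - 1) - 1) ≠ 0 := fun u hu hu0 =>
    mul_ne_zero (by linarith)
      (right_ne_zero_of_mul (mul_one_add_rpow_sub_one_pos hp hu hu0).ne')
  have hmono := strictMonoOn_chicone_function (a := -1) (by norm_num)
    (fun u hu => hasDerivAt_potential hp hu) (fun u hu => hasDerivAt_deriv_potential hu)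
    (fun u hu => ((hasDerivAt_one_add_rpow_sub_one hu).const_mul p).sub_const 1)
    (continuousAt_const.mul ((continuousAt_const.mul
      (hasDerivAt_one_add_rpow_sub_one (by norm_num)).continuousAt).div
      (continuousAt_const.add continuousAt_id) (by simp)))
    (potential_zero hp) (by simp) (by simpa using (sub_pos.2 hp).ne') hne
    (fun u hu hu0 => chicone_numerator_pos hp hu hu0 rfl)
  refine hmono.congr fun u hu => ?_
  have hd := hasDerivAt_div_deriv_sq
    (W₁ := fun v : ℝ => (1 + v) * ((1 + v) ^ (p - 1) - 1))
    (W₂ := fun v : ℝ => p * (1 + v) ^ (p - 1) - 1) (hasDerivAt_potential hp hu.1)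
    (hasDerivAt_deriv_potential hu.1) (hne u hu.1 hu.2)
  refine hd.deriv.symm.trans (Eq.trans (Filter.EventuallyEq.deriv_eq ?_) (hC u).symm)
  filter_upwards [Ioi_mem_nhds hu.1] with v hv
  rw [(hasDerivAt_potential hp hv).deriv]
end

section
/- For any p > 3, the derivative of f_p(t) = (sinh(p t) - p sinh(t)) / (4 sinh^3((p-1)t/2)) satisfies f_p'(t) < 0 for all t > 0; that is, f_p is strictly decreasing on (0, ∞). -/
open Real in
/-- For `a > 1`, the rational function of `sinh (a t)` and `cosh (a t)` below strictly dominates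
`tanh ((a + 1) t)`, written here without denominators. -/
theorem sinh_mul_lt_mul_cosh {a t : ℝ} (ha : 1 < a) (ht : 0 < t) :
    (3 * a ^ 2 + (3 * a ^ 2 + (2 * a + 1)) * sinh (a * t) ^ 2) * sinh ((a + 1) * t)
      < 3 * a * (a + 1) * (cosh (a * t) * sinh (a * t)) * cosh ((a + 1) * t) := by
  set P : ℝ → ℝ := fun s => 3 * a ^ 2 + (3 * a ^ 2 + (2 * a + 1)) * sinh (a * s) ^ 2 with hP
  set W : ℝ → ℝ := fun s => 3 * a * (a + 1) * (cosh (a * s) * sinh (a * s)) with hW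
  have hpos : ∀ s, 0 ≤ s → 0 < P s + W s := by
    intro s hs
    have h1 : 0 ≤ sinh (a * s) := sinh_nonneg_iff.2 (by positivity)
    have h2 := cosh_pos (a * s)
    simp only [hP, hW]
    positivity
  have hS : ∀ s, HasDerivAt (fun s => sinh (a * s)) (cosh (a * s) * a) s := fun s => by
    simpa using ((hasDerivAt_id s).const_mul a).sinh
  have hC : ∀ s, HasDerivAt (fun s => cosh (a * s)) (sinh (a * s) * a) s := fun s => by
    simpa using ((hasDerivAt_id s).const_mul a).cosh
  have hE : ∀ s, HasDerivAt (fun s => exp (2 * (a + 1) * s))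
      (exp (2 * (a + 1) * s) * (2 * (a + 1))) s := fun s => by
    simpa using ((hasDerivAt_id s).const_mul (2 * (a + 1))).exp
  have hPd := fun s => (((hS s).pow 2).const_mul (3 * a ^ 2 + (2 * a + 1))).const_add (3 * a ^ 2)
  have hWd := fun s => ((hC s).mul (hS s)).const_mul (3 * a * (a + 1))
  have hanti : StrictAntiOn (fun s => (P s - W s) * exp (2 * (a + 1) * s) / (P s + W s))
      (Set.Ici 0) := by
    refine strictAntiOn_of_deriv_neg (convex_Ici 0) ?_ ?_
    · refine ContinuousOn.div (by fun_prop) (by fun_prop) fun s hs => (hpos s hs).ne'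
    · intro s hs
      rw [interior_Ici, Set.mem_Ioi] at hs
      have hd := (((hPd s).sub (hWd s)).mul (hE s)).div ((hPd s).add (hWd s)) (hpos s hs.le).ne'
      refine (hd.deriv.trans_lt (div_neg_of_neg_of_pos ?_ (pow_pos (hpos s hs.le) 2)))
      have hx : 0 < sinh (a * s) := sinh_pos_iff.2 (by positivity)
      have hneg : 0 < exp (2 * (a + 1) * s) *
          (2 * (a + 1) * (2 * a + 1) * ((3 * a + 1) * (a - 1)) * sinh (a * s) ^ 4) := by
        have : 0 < a - 1 := by linarith
        positivity
      refine lt_of_eq_of_lt ?_ (neg_neg_of_pos hneg)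
      have hc := cosh_sq (a * s)
      simp only [Pi.add_apply, Pi.sub_apply, Pi.mul_apply, Pi.pow_apply]
      generalize exp (2 * (a + 1) * s) = e
      generalize sinh (a * s) = S at *
      generalize cosh (a * s) = C at *
      push_cast
      linear_combination (e * (2 * (2 * (3 * a ^ 2 + (2 * a + 1)) * 3 * a ^ 2 * (a + 1) * S ^ 2
        - 9 * a ^ 2 * (a + 1) ^ 3 * S ^ 2
        - 3 * a ^ 2 * (a + 1) * (3 * a ^ 2 + (3 * a ^ 2 + (2 * a + 1)) * S ^ 2)))) * hc
  have hlt := hanti Set.self_mem_Ici ht.le ht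
  have h0 : (P 0 - W 0) * exp (2 * (a + 1) * 0) / (P 0 + W 0) = 1 := by
    have : a ≠ 0 := by linarith
    simp [hP, hW, this]
  simp only [h0] at hlt
  rw [div_lt_one (hpos t ht.le)] at hlt
  change P t * _ < W t * _
  have he : exp (2 * (a + 1) * t) = exp ((a + 1) * t) * exp ((a + 1) * t) := by
    rw [← exp_add]; ring_nf
  have hi : exp ((a + 1) * t) * exp (-((a + 1) * t)) = 1 := by
    rw [← exp_add]; simp
  have hm := mul_lt_mul_of_pos_right hlt (exp_pos (-((a + 1) * t)))
  rw [he] at hm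
  rw [sinh_eq, cosh_eq]
  linear_combination hm / 2 - (P t - W t) * exp ((a + 1) * t) / 2 * hi

/-- For `p > 3`, the function
`f_p(t) = (sinh(pt) - p sinh t)/(4 sinh³((p-1)t/2))` satisfies `f_p'(t) < 0`
for all `t > 0`; that is, `f_p` is strictly decreasing on `(0, ∞)`. -/
theorem fp_deriv_neg_of_p_gt_three
    (p : ℝ) (hp : 3 < p)
    (f : ℝ → ℝ)
    (hf : ∀ t : ℝ, f t = (Real.sinh (p * t) - p * Real.sinh t)
      / (4 * (Real.sinh ((p - 1) / 2 * t)) ^ 3)) :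
    (∀ t : ℝ, 0 < t → deriv f t < 0) ∧ StrictAntiOn f (Set.Ioi 0) := by
  obtain ⟨a, rfl⟩ : ∃ a, p = 2 * a + 1 := ⟨(p - 1) / 2, by ring⟩
  have ha : 1 < a := by linarith
  have hfun : f = fun t => (Real.sinh ((2 * a + 1) * t) - (2 * a + 1) * Real.sinh t)
      / (4 * Real.sinh (a * t) ^ 3) := by
    funext t
    rw [hf, show (2 * a + 1 - 1) / 2 = a by ring]
  have hpos : ∀ t, 0 < t → 0 < Real.sinh (a * t) := fun t ht =>
    Real.sinh_pos_iff.2 (by positivity)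
  have hderiv : ∀ t, 0 < t → deriv f t < 0 := by
    intro t ht
    have hS := hpos t ht
    have hmul : ∀ c : ℝ, HasDerivAt (fun s => Real.sinh (c * s)) (Real.cosh (c * t) * c) t :=
      fun c => by simpa using ((hasDerivAt_id t).const_mul c).sinh
    have hd := ((hmul (2 * a + 1)).sub ((Real.hasDerivAt_sinh t).const_mul (2 * a + 1))).div
      (((hmul a).pow 3).const_mul 4) (by simp only [Pi.pow_apply]; positivity)
    rw [hfun]
    refine hd.deriv.trans_lt (div_neg_of_neg_of_pos ?_ (by simp only [Pi.pow_apply]; positivity))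
    have key := mul_lt_mul_of_pos_left (sinh_mul_lt_mul_cosh ha ht)
      (show 0 < 8 * Real.sinh (a * t) ^ 2 by positivity)
    have e1 : (2 * a + 1) * t = (a + 1) * t + a * t := by ring
    have e2 : Real.sinh t = Real.sinh ((a + 1) * t - a * t) := by ring_nf
    have e3 : Real.cosh t = Real.cosh ((a + 1) * t - a * t) := by ring_nf
    simp only [Pi.sub_apply, Pi.pow_apply]
    rw [e1, e2, e3, Real.sinh_add, Real.sinh_sub, Real.cosh_add, Real.cosh_sub]
    have hc := Real.cosh_sq (a * t)
    generalize Real.sinh (a * t) = S at *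
    generalize Real.cosh (a * t) = C at *
    generalize Real.sinh ((a + 1) * t) = T at *
    generalize Real.cosh ((a + 1) * t) = D at *
    push_cast
    linear_combination key + 24 * a ^ 2 * S ^ 2 * T * hc
  refine ⟨hderiv, strictAntiOn_of_deriv_neg (convex_Ioi 0) ?_ fun t ht => hderiv t ?_⟩
  · rw [hfun]
    refine ContinuousOn.div (by fun_prop) (by fun_prop) fun t ht => ?_
    have := hpos t ht
    positivity
  · rwa [interior_Ioi] at ht
end

section
/- For any p with 1 < p < 3, the derivative of f_p(t) = (sinh(p t) - p sinh(t)) / (4 sinh^3((p-1)t/2)) satisfies f_p'(t) > 0 for all t > 0; that is, f_p is strictly increasing on (0, ∞). -/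
/-- Weighted Jensen inequality for `x ↦ x ^ k` at the points `(b + 2a)²` and `(b - 2a)²`, whose
mean with weights proportional to `b - a` and `b + a` is `b²`. -/
theorem mul_sq_pow_le_weighted_sum {a b : ℝ} (ha : 0 < a) (hab : a ≤ b) (k : ℕ) :
    b * (b ^ 2) ^ k ≤
      (b - a) / 2 * ((b + 2 * a) ^ 2) ^ k + (b + a) / 2 * ((b - 2 * a) ^ 2) ^ k := by
  have hb : 0 < b := ha.trans_le hab
  have hpow := (convexOn_pow (𝕜 := ℝ) k).2
  have hconv := hpow (x := (b + 2 * a) ^ 2) (y := (b - 2 * a) ^ 2)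
    (Set.mem_Ici.2 (sq_nonneg _)) (Set.mem_Ici.2 (sq_nonneg _))
    (a := (b - a) / (2 * b)) (b := (b + a) / (2 * b))
    (div_nonneg (by linarith) (by linarith)) (div_nonneg (by linarith) (by linarith))
    (by field_simp; ring)
  simp only [smul_eq_mul] at hconv
  have hmean : (b - a) / (2 * b) * (b + 2 * a) ^ 2 + (b + a) / (2 * b) * (b - 2 * a) ^ 2
      = b ^ 2 := by
    field_simp
    ring
  rw [hmean] at hconv
  refine (mul_le_mul_of_nonneg_left hconv hb.le).trans_eq ?_
  field_simp

theorem sinh_combination_pos {a b t : ℝ} (ha : 0 < a) (hab : 2 * a < b) (ht : 0 < t) :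
    0 < (b - a) * (b - 2 * a) / 2 * Real.sinh ((b + 2 * a) * t)
      + (b + a) * (b + 2 * a) / 2 * Real.sinh ((b - 2 * a) * t)
      - (b - 2 * a) * (b + 2 * a) * Real.sinh (b * t) := by
  have hsum := (((Real.hasSum_sinh ((b + 2 * a) * t)).mul_left ((b - a) * (b - 2 * a) / 2)).add
    ((Real.hasSum_sinh ((b - 2 * a) * t)).mul_left ((b + a) * (b + 2 * a) / 2))).sub
    ((Real.hasSum_sinh (b * t)).mul_left ((b - 2 * a) * (b + 2 * a)))
  have hfactor : 0 < (b - 2 * a) * (b + 2 * a) := mul_pos (by linarith) (by linarith)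
  have hterm : ∀ n : ℕ,
      (b - a) * (b - 2 * a) / 2 * (((b + 2 * a) * t) ^ (2 * n + 1) / ((2 * n + 1).factorial : ℝ))
        + (b + a) * (b + 2 * a) / 2
          * (((b - 2 * a) * t) ^ (2 * n + 1) / ((2 * n + 1).factorial : ℝ))
        - (b - 2 * a) * (b + 2 * a) * ((b * t) ^ (2 * n + 1) / ((2 * n + 1).factorial : ℝ))
      = (b - 2 * a) * (b + 2 * a) * (t ^ (2 * n + 1) / ((2 * n + 1).factorial : ℝ))
        * ((b - a) / 2 * ((b + 2 * a) ^ 2) ^ n + (b + a) / 2 * ((b - 2 * a) ^ 2) ^ n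
          - b * (b ^ 2) ^ n) := by
    intro n
    simp only [mul_pow _ t, pow_succ _ (2 * n), pow_mul]
    ring
  have hpow : ∀ n : ℕ, 0 < (b - 2 * a) * (b + 2 * a)
      * (t ^ (2 * n + 1) / ((2 * n + 1).factorial : ℝ)) := fun n =>
    mul_pos hfactor (by positivity)
  refine hasSum_lt (f := fun _ => (0 : ℝ)) (i := 2) (fun n => ?_) ?_ hasSum_zero hsum
  · refine le_of_le_of_eq ?_ (hterm n).symm
    exact mul_nonneg (hpow n).le
      (sub_nonneg.2 (mul_sq_pow_le_weighted_sum ha (by linarith) n))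
  · refine lt_of_lt_of_eq ?_ (hterm 2).symm
    refine mul_pos (hpow 2) ?_
    have hquartic : (b - a) / 2 * ((b + 2 * a) ^ 2) ^ 2 + (b + a) / 2 * ((b - 2 * a) ^ 2) ^ 2
        - b * (b ^ 2) ^ 2 = 16 * a ^ 2 * b * ((b - a) * (b + a)) := by ring
    rw [hquartic]
    have hb : 0 < b := by linarith
    have hsub : 0 < b - a := by linarith
    positivity

/-- The derivative of `f_p` at `t`, up to a positive factor. -/
theorem deriv_numerator_pos {p t : ℝ} (hp₁ : 1 < p) (hp₃ : p < 3) (ht : 0 < t) :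
    0 < p * (Real.cosh (p * t) - Real.cosh t) * Real.sinh ((p - 1) / 2 * t)
      - 3 * ((p - 1) / 2) * Real.cosh ((p - 1) / 2 * t)
        * (Real.sinh (p * t) - p * Real.sinh t) := by
  have hpos := sinh_combination_pos (a := (p - 1) / 2) (b := (p + 1) / 2)
    (by linarith) (by linarith) ht
  refine hpos.trans_eq ?_
  set x := (p - 1) / 2 * t with hx
  set y := (p + 1) / 2 * t with hy
  rw [show ((p + 1) / 2 + 2 * ((p - 1) / 2)) * t = y + 2 * x by rw [hx, hy]; ring,
    show ((p + 1) / 2 - 2 * ((p - 1) / 2)) * t = y - 2 * x by rw [hx, hy]; ring,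
    show p * t = y + x by rw [hx, hy]; ring,
    show Real.cosh t = Real.cosh (y - x) by congr 1; rw [hx, hy]; ring,
    show Real.sinh t = Real.sinh (y - x) by congr 1; rw [hx, hy]; ring]
  simp only [Real.sinh_add, Real.sinh_sub, Real.cosh_add, Real.cosh_sub, Real.sinh_two_mul,
    Real.cosh_two_mul, Real.cosh_sq x]
  linear_combination -(3 / 2 * (p - 1) ^ 2 * Real.sinh y) * Real.cosh_sq x

/-- For `1 < p < 3`, the function
`f_p(t) = (sinh(pt) - p sinh t)/(4 sinh³((p-1)t/2))` satisfies `f_p'(t) > 0`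
for all `t > 0`; that is, `f_p` is strictly increasing on `(0, ∞)`. -/
theorem fp_deriv_pos_of_p_lt_three
    (p : ℝ) (hp₁ : 1 < p) (hp₃ : p < 3)
    (f : ℝ → ℝ)
    (hf : ∀ t : ℝ, f t = (Real.sinh (p * t) - p * Real.sinh t)
      / (4 * (Real.sinh ((p - 1) / 2 * t)) ^ 3)) :
    (∀ t : ℝ, 0 < t → 0 < deriv f t) ∧ StrictMonoOn f (Set.Ioi 0) := by
  have hderiv : ∀ t : ℝ, 0 < t → 0 < deriv f t := by
    intro t ht
    have hs : 0 < Real.sinh ((p - 1) / 2 * t) :=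
      Real.sinh_pos_iff.2 (mul_pos (by linarith) ht)
    have hnum : HasDerivAt (fun t => Real.sinh (p * t) - p * Real.sinh t)
        (Real.cosh (p * t) * (p * 1) - p * Real.cosh t) t :=
      ((hasDerivAt_id t).const_mul p).sinh.sub ((Real.hasDerivAt_sinh t).const_mul p)
    have hden := ((((hasDerivAt_id t).const_mul ((p - 1) / 2)).sinh).pow 3).const_mul 4
    have hquot := hnum.div hden (by simpa using hs.ne')
    have hderivf := hquot.congr_of_eventuallyEq (f₁ := f) (.of_forall fun t => by simp [hf])
    rw [hderivf.deriv]
    refine div_pos ?_ (by simpa using pow_pos (mul_pos four_pos (pow_pos hs 3)) 2)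
    refine (mul_pos (mul_pos four_pos (pow_pos hs 2))
      (deriv_numerator_pos hp₁ hp₃ ht)).trans_eq ?_
    simp only [Pi.pow_apply, id, Nat.cast_ofNat]
    ring
  refine ⟨hderiv, strictMonoOn_of_deriv_pos (convex_Ioi 0) (fun t ht => ?_) fun t ht => ?_⟩
  · exact (differentiableAt_of_deriv_ne_zero (hderiv t ht).ne').continuousAt.continuousWithinAt
  · exact hderiv t (by simpa using ht)
end

section
/- Let p > 3 and define h(t) = ((p-3)/4) sinh(((3p-1)/2) t) + ((3p^2 - p)/4) sinh(((p-3)/2) t) - ((3p^2 - 10p + 3)/4) sinh(((p+1)/2) t). Then h(t) > 0 and h is strictly increasing for all t > 0. -/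
/-- The function `x ↦ cosh √x` is strictly convex on the nonnegative reals, stated for squares. -/
theorem cosh_lt_of_sq_eq_convex_combination {x y z u v : ℝ} (hu : 0 < u) (hv : 0 < v)
    (huv : u + v = 1) (hz : z ^ 2 = u * x ^ 2 + v * y ^ 2) (hxy : x ^ 2 ≠ y ^ 2) :
    Real.cosh z < u * Real.cosh x + v * Real.cosh y := by
  have hsum := ((Real.hasSum_cosh x).mul_left u).add ((Real.hasSum_cosh y).mul_left v)
  have hterm (n : ℕ) : u * (x ^ (2 * n) / ↑(2 * n).factorial) +
      v * (y ^ (2 * n) / ↑(2 * n).factorial) =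
      (u * (x ^ 2) ^ n + v * (y ^ 2) ^ n) / ↑(2 * n).factorial := by
    rw [pow_mul, pow_mul]; ring
  refine hasSum_lt (i := 2) (fun n => ?_) ?_ (Real.hasSum_cosh z) hsum
  · dsimp only
    rw [hterm, pow_mul, hz]
    gcongr
    simpa using (convexOn_pow n).2 (sq_nonneg x) (sq_nonneg y) hu.le hv.le huv
  · rw [hterm, pow_mul, hz]
    gcongr
    simpa using (strictConvexOn_pow (n := 2) le_rfl).2 (sq_nonneg x) (sq_nonneg y) hxy hu hv huv

/-- For `p > 3`, the function
`h(t) = ((p-3)/4) sinh(((3p-1)/2)t) + ((3p²-p)/4) sinh(((p-3)/2)t)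
       - ((3p²-10p+3)/4) sinh(((p+1)/2)t)`
is strictly positive and strictly increasing on `(0, ∞)`. -/
theorem h_pos_and_strictMono_of_p_gt_three
    (p : ℝ) (hp : 3 < p)
    (h : ℝ → ℝ)
    (hh : ∀ t : ℝ, h t = (p - 3) / 4 * Real.sinh ((3 * p - 1) / 2 * t)
      + (3 * p ^ 2 - p) / 4 * Real.sinh ((p - 3) / 2 * t)
      - (3 * p ^ 2 - 10 * p + 3) / 4 * Real.sinh ((p + 1) / 2 * t)) :
    (∀ t : ℝ, 0 < t → 0 < h t) ∧ StrictMonoOn h (Set.Ioi 0) := by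
  have hderiv (t : ℝ) : HasDerivAt h ((p - 3) * (3 * p - 1) / 8 * (Real.cosh ((3 * p - 1) / 2 * t)
      + p * Real.cosh ((p - 3) / 2 * t) - (p + 1) * Real.cosh ((p + 1) / 2 * t))) t := by
    have hsinh (a : ℝ) :
        HasDerivAt (fun s : ℝ => Real.sinh (a * s)) (Real.cosh (a * t) * (a * 1)) t :=
      ((hasDerivAt_id t).const_mul a).sinh
    rw [funext hh]
    refine ((((hsinh ((3 * p - 1) / 2)).const_mul ((p - 3) / 4)).add
      ((hsinh ((p - 3) / 2)).const_mul ((3 * p ^ 2 - p) / 4))).sub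
      ((hsinh ((p + 1) / 2)).const_mul ((3 * p ^ 2 - 10 * p + 3) / 4))).congr_deriv ?_
    ring
  have hmono : StrictMonoOn h (Set.Ici 0) := by
    refine strictMonoOn_of_deriv_pos (convex_Ici 0)
      (fun t _ => (hderiv t).continuousAt.continuousWithinAt) fun t ht => ?_
    rw [interior_Ici, Set.mem_Ioi] at ht
    rw [(hderiv t).deriv]
    have hp1 : 0 < p + 1 := by linarith
    have hp0 : 0 < p := by linarith
    have hcosh : Real.cosh ((p + 1) / 2 * t) < 1 / (p + 1) * Real.cosh ((3 * p - 1) / 2 * t)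
        + p / (p + 1) * Real.cosh ((p - 3) / 2 * t) := by
      refine cosh_lt_of_sq_eq_convex_combination (by positivity) (by positivity)
        (by field_simp; ring) (by field_simp; ring) (ne_of_gt ?_)
      have : (p - 3) / 2 * t < (3 * p - 1) / 2 * t := by gcongr ?_ / 2 * t; linarith
      have : 0 ≤ (p - 3) / 2 * t := mul_nonneg (by linarith) ht.le
      gcongr
    have hscaled := mul_lt_mul_of_pos_left hcosh hp1
    have hcancel : (p + 1) * (1 / (p + 1) * Real.cosh ((3 * p - 1) / 2 * t)
        + p / (p + 1) * Real.cosh ((p - 3) / 2 * t)) =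
        Real.cosh ((3 * p - 1) / 2 * t) + p * Real.cosh ((p - 3) / 2 * t) := by
      field_simp
    rw [hcancel] at hscaled
    have hp3 : 0 < p - 3 := by linarith
    have hc : 0 < 3 * p - 1 := by linarith
    exact mul_pos (by positivity) (by linarith)
  refine ⟨fun t ht => ?_, hmono.mono Set.Ioi_subset_Ici_self⟩
  have h0 : h 0 = 0 := by simp [hh]
  exact h0 ▸ hmono Set.self_mem_Ici ht.le ht
end

section
/- Let 1 < p < 3 and define h(t) = ((p-3)/4) sinh(((3p-1)/2) t) + ((3p^2 - p)/4) sinh(((p-3)/2) t) - ((3p^2 - 10p + 3)/4) sinh(((p+1)/2) t). Then h(t) < 0 and h is strictly decreasing for all t > 0. -/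
/-- For `p > 1`, `p * sinh t < sinh (p * t)` on the positive half-line. -/
lemma mul_sinh_lt_sinh_mul {p t : ℝ} (hp : 1 < p) (ht : 0 < t) :
    p * Real.sinh t < Real.sinh (p * t) := by
  have hderiv : ∀ x : ℝ, HasDerivAt (fun x => Real.sinh (p * x) - p * Real.sinh x)
      (Real.cosh (p * x) * (p * 1) - p * Real.cosh x) x := fun x =>
    (((hasDerivAt_id x).const_mul p).sinh).sub ((Real.hasDerivAt_sinh x).const_mul p)
  have hmono : StrictMonoOn (fun x => Real.sinh (p * x) - p * Real.sinh x) (Set.Ici 0) := by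
    refine strictMonoOn_of_deriv_pos (convex_Ici 0)
      (fun x _ => (hderiv x).continuousAt.continuousWithinAt) fun x hx => ?_
    rw [interior_Ici, Set.mem_Ioi] at hx
    have hcosh : Real.cosh x < Real.cosh (p * x) := by
      rw [Real.cosh_lt_cosh, abs_of_pos hx, abs_of_pos (by positivity)]
      nlinarith
    rw [(hderiv x).deriv]
    nlinarith
  have := hmono Set.self_mem_Ici ht.le ht
  simp only [mul_zero, Real.sinh_zero, sub_zero] at this
  linarith

/-- Product formula for the combination of hyperbolic cosines with frequencies
`(3p-1)/2`, `(p-3)/2` and `(p+1)/2`. -/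
lemma cosh_add_mul_cosh_sub_mul_cosh (p t : ℝ) :
    Real.cosh ((3 * p - 1) / 2 * t) + p * Real.cosh ((p - 3) / 2 * t)
      - (p + 1) * Real.cosh ((p + 1) / 2 * t)
      = 2 * Real.sinh ((p - 1) / 2 * t) * (Real.sinh (p * t) - p * Real.sinh t) := by
  have hsinh (x y : ℝ) :
      2 * Real.sinh x * Real.sinh y = Real.cosh (y + x) - Real.cosh (y - x) := by
    rw [Real.cosh_add, Real.cosh_sub]
    ring
  have hp := hsinh ((p - 1) / 2 * t) (p * t)
  have h1 := hsinh t ((p - 1) / 2 * t)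
  rw [show p * t + (p - 1) / 2 * t = (3 * p - 1) / 2 * t by ring,
    show p * t - (p - 1) / 2 * t = (p + 1) / 2 * t by ring] at hp
  rw [show (p - 1) / 2 * t + t = (p + 1) / 2 * t by ring,
    show (p - 1) / 2 * t - t = (p - 3) / 2 * t by ring] at h1
  linear_combination p * h1 - hp


/-- For `1 < p < 3`, the function
`h(t) = ((p-3)/4) sinh(((3p-1)/2)t) + ((3p²-p)/4) sinh(((p-3)/2)t)
       - ((3p²-10p+3)/4) sinh(((p+1)/2)t)`
is strictly negative and strictly decreasing on `(0, ∞)`. -/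
theorem h_neg_and_strictAnti_of_p_lt_three
    (p : ℝ) (hp₁ : 1 < p) (hp₃ : p < 3)
    (h : ℝ → ℝ)
    (hh : ∀ t : ℝ, h t = (p - 3) / 4 * Real.sinh ((3 * p - 1) / 2 * t)
      + (3 * p ^ 2 - p) / 4 * Real.sinh ((p - 3) / 2 * t)
      - (3 * p ^ 2 - 10 * p + 3) / 4 * Real.sinh ((p + 1) / 2 * t)) :
    (∀ t : ℝ, 0 < t → h t < 0) ∧ StrictAntiOn h (Set.Ioi 0) := by
  have hderiv : ∀ t : ℝ, HasDerivAt h ((p - 3) * (3 * p - 1) / 8 *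
      (2 * Real.sinh ((p - 1) / 2 * t) * (Real.sinh (p * t) - p * Real.sinh t))) t := by
    intro t
    have hsinh (a : ℝ) :
        HasDerivAt (fun x => Real.sinh (a * x)) (Real.cosh (a * t) * (a * 1)) t :=
      ((hasDerivAt_id t).const_mul a).sinh
    rw [funext hh, ← cosh_add_mul_cosh_sub_mul_cosh]
    refine HasDerivAt.congr_deriv ((((hsinh ((3 * p - 1) / 2)).const_mul ((p - 3) / 4)).add
      ((hsinh ((p - 3) / 2)).const_mul ((3 * p ^ 2 - p) / 4))).sub
      ((hsinh ((p + 1) / 2)).const_mul ((3 * p ^ 2 - 10 * p + 3) / 4))) ?_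
    ring
  have hanti : StrictAntiOn h (Set.Ici 0) := by
    refine strictAntiOn_of_deriv_neg (convex_Ici 0)
      (fun t _ => (hderiv t).continuousAt.continuousWithinAt) fun t ht => ?_
    rw [interior_Ici, Set.mem_Ioi] at ht
    rw [(hderiv t).deriv]
    have hcoeff : (p - 3) * (3 * p - 1) / 8 < 0 := by nlinarith
    have hsinh : 0 < Real.sinh ((p - 1) / 2 * t) :=
      Real.sinh_pos_iff.2 (mul_pos (by linarith) ht)
    exact mul_neg_of_neg_of_pos hcoeff
      (mul_pos (by positivity) (sub_pos.2 (mul_sinh_lt_sinh_mul hp₁ ht)))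
  refine ⟨fun t ht => ?_, hanti.mono Set.Ioi_subset_Ici_self⟩
  have h0 : h 0 = 0 := by simp [hh]
  simpa [h0] using hanti Set.self_mem_Ici ht.le ht
end

section
/- For any p > 1, the function f_p(t) = (sinh(p t) - p sinh(t)) / (4 sinh^3((p-1)t/2)) satisfies f_p'(t) + ((p+3)/2) f_p(t) > 0 for all t > 0. -/
open Finset in
/-- If `g` is a sum of exponentials vanishing at `0` and `g' - r g` is positive on `(0, ∞)`,
then `g` is positive on `(0, ∞)`. -/
theorem exp_sum_pos_of_shifted_pos {ι : Type*} [Fintype ι] (c l : ι → ℝ) (r : ℝ)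
    (h0 : ∑ i, c i = 0)
    (h : ∀ t : ℝ, 0 < t → 0 < ∑ i, ((l i - r) * c i) * Real.exp (l i * t)) :
    ∀ t : ℝ, 0 < t → 0 < ∑ i, c i * Real.exp (l i * t) := by
  have hd : ∀ t : ℝ, HasDerivAt (fun t => ∑ i, c i * Real.exp ((l i - r) * t))
      (∑ i, c i * (Real.exp ((l i - r) * t) * (l i - r))) t := by
    intro t
    refine HasDerivAt.fun_sum fun i _ => ?_
    simpa using (((hasDerivAt_id t).const_mul (l i - r)).exp).const_mul (c i)
  have hexp : ∀ i t, Real.exp ((l i - r) * t) = Real.exp (-(r * t)) * Real.exp (l i * t) := by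
    intro i t
    rw [← Real.exp_add]
    ring_nf
  have hmono : StrictMonoOn (fun t => ∑ i, c i * Real.exp ((l i - r) * t)) (Set.Ici 0) := by
    refine strictMonoOn_of_deriv_pos (convex_Ici 0)
      (fun t _ => (hd t).continuousAt.continuousWithinAt) fun t ht => ?_
    rw [interior_Ici, Set.mem_Ioi] at ht
    rw [(hd t).deriv]
    have := mul_pos (Real.exp_pos (-(r * t))) (h t ht)
    rw [mul_sum] at this
    refine this.trans_eq (sum_congr rfl fun i _ => ?_)
    rw [hexp]
    ring
  intro t ht
  have hlt := hmono Set.self_mem_Ici (Set.mem_Ici.2 ht.le) ht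
  simp only [mul_zero, Real.exp_zero, mul_one, h0] at hlt
  refine pos_of_mul_pos_right (a := Real.exp (-(r * t))) (hlt.trans_eq ?_) (Real.exp_pos _).le
  rw [mul_sum]
  refine sum_congr rfl fun i _ => ?_
  rw [hexp]
  ring

/-- Positivity on `(0, ∞)` of the exponential sum to which the differential inequality reduces,
with `q = (p - 1) / 2`. It vanishes to order four at `0`, and `(D² - (1 - q)²) (D² - (1 + q)²)`
leaves only two terms, both positive. -/
theorem six_exp_sum_pos (q : ℝ) (hq : 0 < q) (t : ℝ) (ht : 0 < t) :
    0 < 3 * Real.exp ((3 * q + 1) * t) + (2 * q + 1) * Real.exp (-(3 * q + 1) * t)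
      + 2 * (2 * q + 1) * (q - 3) * Real.exp ((q + 1) * t)
      + -(8 * q ^ 2 + 2 * q + 2) * Real.exp (-(q + 1) * t)
      + (2 * q + 1) * (4 * q + 3) * Real.exp ((1 - q) * t)
      + (2 * q + 1) * (1 - 2 * q) * Real.exp (-(1 - q) * t) := by
  have key := exp_sum_pos_of_shifted_pos
    ![3, 2 * q + 1, 2 * (2 * q + 1) * (q - 3), -(8 * q ^ 2 + 2 * q + 2),
      (2 * q + 1) * (4 * q + 3), (2 * q + 1) * (1 - 2 * q)]
    ![3 * q + 1, -(3 * q + 1), q + 1, -(q + 1), 1 - q, -(1 - q)] (q + 1)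
    (by simp [Fin.sum_univ_six]; ring)
    (exp_sum_pos_of_shifted_pos _ _ (-(q + 1)) (by simp [Fin.sum_univ_six]; ring)
      (exp_sum_pos_of_shifted_pos _ _ (1 - q) (by simp [Fin.sum_univ_six]; ring)
        (exp_sum_pos_of_shifted_pos _ _ (-(1 - q)) (by simp [Fin.sum_univ_six]; ring) ?_))) t ht
  · simpa [Fin.sum_univ_six] using key
  · intro s _
    have hpos : 0 < (2 * q + 2) * (4 * q) * ((2 * q) * (4 * q + 2))
        * (3 * Real.exp ((3 * q + 1) * s) + (2 * q + 1) * Real.exp (-(3 * q + 1) * s)) := by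
      positivity
    refine hpos.trans_eq ?_
    simp only [Fin.sum_univ_six, Matrix.cons_val]
    ring

/-- The numerator of `f_p' + ((p + 3) / 2) f_p`, with `p = 2 q + 1`, as a sum of exponentials. -/
theorem numerator_eq_exp_sum (q t : ℝ) :
    4 * ((2 * q + 1) * (Real.cosh ((2 * q + 1) * t) - Real.cosh t) * Real.sinh (q * t)
      + (q + 2) * (Real.sinh ((2 * q + 1) * t) - (2 * q + 1) * Real.sinh t) * Real.sinh (q * t)
      - 3 * q * (Real.sinh ((2 * q + 1) * t) - (2 * q + 1) * Real.sinh t) * Real.cosh (q * t))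
    = 3 * Real.exp ((3 * q + 1) * t) + (2 * q + 1) * Real.exp (-(3 * q + 1) * t)
      + 2 * (2 * q + 1) * (q - 3) * Real.exp ((q + 1) * t)
      + -(8 * q ^ 2 + 2 * q + 2) * Real.exp (-(q + 1) * t)
      + (2 * q + 1) * (4 * q + 3) * Real.exp ((1 - q) * t)
      + (2 * q + 1) * (1 - 2 * q) * Real.exp (-(1 - q) * t) := by
  have h1 : Real.exp ((2 * q + 1) * t) = Real.exp (q * t) ^ 2 * Real.exp t := by
    rw [← Real.exp_nat_mul, ← Real.exp_add]; push_cast; ring_nf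
  have h2 : Real.exp ((3 * q + 1) * t) = Real.exp (q * t) ^ 3 * Real.exp t := by
    rw [← Real.exp_nat_mul, ← Real.exp_add]; push_cast; ring_nf
  have h3 : Real.exp ((q + 1) * t) = Real.exp (q * t) * Real.exp t := by
    rw [← Real.exp_add]; ring_nf
  have h4 : Real.exp ((1 - q) * t) = Real.exp t / Real.exp (q * t) := by
    rw [← Real.exp_sub]; ring_nf
  simp only [Real.sinh_eq, Real.cosh_eq, neg_mul, Real.exp_neg, h1, h2, h3, h4]
  have hx := Real.exp_ne_zero t
  have hy := Real.exp_ne_zero (q * t)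
  field_simp
  ring

/-- For any `p > 1`, the function
`f_p(t) = (sinh(pt) - p sinh t)/(4 sinh³((p-1)t/2))` satisfies
`f_p'(t) + ((p+3)/2) f_p(t) > 0` for all `t > 0`. -/
theorem fp_deriv_add_pos
    (p : ℝ) (hp : 1 < p)
    (f : ℝ → ℝ)
    (hf : ∀ t : ℝ, f t = (Real.sinh (p * t) - p * Real.sinh t)
      / (4 * (Real.sinh ((p - 1) / 2 * t)) ^ 3)) :
    ∀ t : ℝ, 0 < t → 0 < deriv f t + (p + 3) / 2 * f t := by
  intro t ht
  obtain ⟨q, rfl⟩ : ∃ q, p = 2 * q + 1 := ⟨(p - 1) / 2, by ring⟩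
  have hq : 0 < q := by linarith
  have hq' : (2 * q + 1 - 1) / 2 = q := by ring
  simp only [hq'] at hf
  have hS : 0 < Real.sinh (q * t) := Real.sinh_pos_iff.2 (mul_pos hq ht)
  have hN : HasDerivAt (fun t => Real.sinh ((2 * q + 1) * t) - (2 * q + 1) * Real.sinh t)
      (Real.cosh ((2 * q + 1) * t) * (2 * q + 1) - (2 * q + 1) * Real.cosh t) t := by
    simpa using (((hasDerivAt_id t).const_mul (2 * q + 1)).sinh).fun_sub
      ((Real.hasDerivAt_sinh t).const_mul (2 * q + 1))
  have hD : HasDerivAt (fun t => 4 * Real.sinh (q * t) ^ 3)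
      (4 * (3 * Real.sinh (q * t) ^ 2 * (Real.cosh (q * t) * q))) t := by
    simpa using ((((hasDerivAt_id t).const_mul q).sinh).pow 3).const_mul 4
  have hF := hN.div hD (by positivity)
  have hpos := six_exp_sum_pos q hq t ht
  rw [← numerator_eq_exp_sum] at hpos
  have hfe : f = (fun t => Real.sinh ((2 * q + 1) * t) - (2 * q + 1) * Real.sinh t) /
      (fun t => 4 * Real.sinh (q * t) ^ 3) := funext hf
  rw [hf t, hfe, hF.deriv]
  refine (div_pos hpos (by positivity : 0 < 16 * Real.sinh (q * t) ^ 4)).trans_eq ?_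
  field_simp
  ring
end

section
/- Let 1 < p ≤ 7 and define S(t) = (1/8)[(p+3)(p+1)(cosh(((p+1)/2) t) - cosh(((p-3)/2) t)) - (3p-1)(p-3) sinh(((p+1)/2) t) + (3p-1)(p+1) sinh(((p-3)/2) t)]. Then S(t) > 0 and S is strictly increasing for all t > 0. -/
open Real Set

/-- A positive expression: the derivative of the one in `aux_deriv_pos` is it times
`2 * exp (2 * b * t)`. -/
lemma aux_bracket_pos {b t : ℝ} (hb : -1 < b) (hb2 : b ≤ 2) (ht : 0 < t) :
    0 < (2 - b) * (2 * b + 3) * (b + 1) * exp (2 * t)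
      + (4 * b ^ 2 + 9 * b + 6) * exp (-(2 * b + 2) * t) + (2 * b + 1) * b ^ 2 := by
  have hA : 0 ≤ (2 - b) * (2 * b + 3) * (b + 1) :=
    mul_nonneg (mul_nonneg (by linarith) (by linarith)) (by linarith)
  have hB : 0 < 4 * b ^ 2 + 9 * b + 6 := by nlinarith [sq_nonneg (b + 9 / 8)]
  rcases le_total 0 b with h0 | h0
  · positivity
  · have h1 := mul_le_mul_of_nonneg_left (add_one_le_exp (2 * t)) hA
    have h2 := mul_le_mul_of_nonneg_left (add_one_le_exp (-(2 * b + 2) * t)) hB.le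
    have h3 : 0 ≤ t * ((-b) * (b + 1) * (3 * b + 4)) :=
      mul_nonneg ht.le (mul_nonneg (mul_nonneg (by linarith) (by linarith)) (by linarith))
    have h4 : 0 < (b + 1) * (b + 3) := mul_pos (by linarith) (by linarith)
    nlinarith

/-- The derivative of `S`, multiplied by `exp (b * t)` and a positive constant, with
`b = (p - 3) / 2`. -/
lemma aux_deriv_pos {b t : ℝ} (hb : -1 < b) (hb2 : b ≤ 2) (ht : 0 < t) :
    0 < (2 - b) * (2 * b + 3) * exp ((2 * b + 2) * t) - (4 * b ^ 2 + 9 * b + 6) * exp (-2 * t)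
      + (2 * b + 1) * b * exp (2 * b * t) + (4 * b + 7) * b := by
  let G : ℝ → ℝ := fun t ↦
    (2 - b) * (2 * b + 3) * exp ((2 * b + 2) * t) - (4 * b ^ 2 + 9 * b + 6) * exp (-2 * t)
      + (2 * b + 1) * b * exp (2 * b * t) + (4 * b + 7) * b
  have hexp (c x : ℝ) : HasDerivAt (fun t ↦ exp (c * t)) (exp (c * x) * c) x := by
    simpa using ((hasDerivAt_id x).const_mul c).exp
  have hG (x : ℝ) : HasDerivAt G (2 * exp (2 * b * x) *
      ((2 - b) * (2 * b + 3) * (b + 1) * exp (2 * x)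
      + (4 * b ^ 2 + 9 * b + 6) * exp (-(2 * b + 2) * x) + (2 * b + 1) * b ^ 2)) x := by
    refine HasDerivAt.congr_deriv (((((hexp (2 * b + 2) x).const_mul ((2 - b) * (2 * b + 3))).sub
      ((hexp (-2) x).const_mul (4 * b ^ 2 + 9 * b + 6))).add
      ((hexp (2 * b) x).const_mul ((2 * b + 1) * b))).add_const ((4 * b + 7) * b)) ?_
    have e1 : exp ((2 * b + 2) * x) = exp (2 * b * x) * exp (2 * x) := by
      rw [← exp_add]; ring_nf
    have e2 : exp (-2 * x) = exp (2 * b * x) * exp (-(2 * b + 2) * x) := by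
      rw [← exp_add]; ring_nf
    rw [e1, e2]; ring
  have hmono : StrictMonoOn G (Ici 0) := by
    refine strictMonoOn_of_deriv_pos (convex_Ici 0)
      (fun x _ ↦ (hG x).continuousAt.continuousWithinAt) fun x hx ↦ ?_
    rw [interior_Ici] at hx
    rw [(hG x).deriv]
    exact mul_pos (by positivity) (aux_bracket_pos hb hb2 hx)
  have h := hmono self_mem_Ici ht.le ht
  have h0 : G 0 = 0 := by simp only [G, mul_zero, exp_zero]; ring
  rwa [h0] at h

/-- For `1 < p ≤ 7`, the function
`S(t) = (1/8)[(p+3)(p+1)(cosh(((p+1)/2)t) - cosh(((p-3)/2)t))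
        - (3p-1)(p-3) sinh(((p+1)/2)t) + (3p-1)(p+1) sinh(((p-3)/2)t)]`
is strictly positive and strictly increasing on `(0, ∞)`. -/
theorem S_pos_and_strictMono
    (p : ℝ) (hp₁ : 1 < p) (hp₇ : p ≤ 7)
    (S : ℝ → ℝ)
    (hS : ∀ t : ℝ, S t = 1 / 8 *
      ((p + 3) * (p + 1) * (Real.cosh ((p + 1) / 2 * t) - Real.cosh ((p - 3) / 2 * t))
        - (3 * p - 1) * (p - 3) * Real.sinh ((p + 1) / 2 * t)
        + (3 * p - 1) * (p + 1) * Real.sinh ((p - 3) / 2 * t))) :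
    (∀ t : ℝ, 0 < t → 0 < S t) ∧ StrictMonoOn S (Set.Ioi 0) := by
  have hd (x : ℝ) : HasDerivAt S ((p + 1) / 8 * exp (-((p - 3) / 2) * x) *
      ((2 - (p - 3) / 2) * (2 * ((p - 3) / 2) + 3) * exp ((2 * ((p - 3) / 2) + 2) * x)
      - (4 * ((p - 3) / 2) ^ 2 + 9 * ((p - 3) / 2) + 6) * exp (-2 * x)
      + (2 * ((p - 3) / 2) + 1) * ((p - 3) / 2) * exp (2 * ((p - 3) / 2) * x)
      + (4 * ((p - 3) / 2) + 7) * ((p - 3) / 2))) x := by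
    have hlin (c : ℝ) : HasDerivAt (fun t ↦ c * t) c x := by
      simpa using (hasDerivAt_id x).const_mul c
    rw [funext hS]
    refine HasDerivAt.congr_deriv ((((((hlin ((p + 1) / 2)).cosh.sub (hlin ((p - 3) / 2)).cosh).const_mul
      ((p + 3) * (p + 1))).sub
      ((hlin ((p + 1) / 2)).sinh.const_mul ((3 * p - 1) * (p - 3)))).add
      ((hlin ((p - 3) / 2)).sinh.const_mul ((3 * p - 1) * (p + 1)))).const_mul (1 / 8)) ?_
    have e1 : exp ((2 * ((p - 3) / 2) + 2) * x)
        = exp ((p - 3) / 2 * x) * exp ((p + 1) / 2 * x) := by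
      rw [← exp_add]; ring_nf
    have e2 : exp (-2 * x) = exp ((p - 3) / 2 * x) * exp (-((p + 1) / 2 * x)) := by
      rw [← exp_add]; ring_nf
    have e3 : exp (2 * ((p - 3) / 2) * x) = exp ((p - 3) / 2 * x) * exp ((p - 3) / 2 * x) := by
      rw [← exp_add]; ring_nf
    have e4 : exp (-((p - 3) / 2) * x) = (exp ((p - 3) / 2 * x))⁻¹ := by
      rw [← exp_neg]; ring_nf
    rw [e1, e2, e3, e4, cosh_eq, cosh_eq, sinh_eq, sinh_eq, exp_neg ((p - 3) / 2 * x)]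
    have hne := (exp_pos ((p - 3) / 2 * x)).ne'
    field_simp
    ring
  have hmono : StrictMonoOn S (Ici 0) := by
    refine strictMonoOn_of_deriv_pos (convex_Ici 0)
      (fun x _ ↦ (hd x).continuousAt.continuousWithinAt) fun x hx ↦ ?_
    rw [interior_Ici] at hx
    rw [(hd x).deriv]
    exact mul_pos (mul_pos (by linarith) (exp_pos _))
      (aux_deriv_pos (by linarith) (by linarith) hx)
  refine ⟨fun t ht ↦ ?_, hmono.mono Ioi_subset_Ici_self⟩
  have h := hmono self_mem_Ici ht.le ht
  have h0 : S 0 = 0 := by simp [hS]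
  rwa [h0] at h
end

section
/- Let p > 7 and define S(t) = (1/8)[(p+3)(p+1)(cosh(((p+1)/2) t) - cosh(((p-3)/2) t)) - (3p-1)(p-3) sinh(((p+1)/2) t) + (3p-1)(p+1) sinh(((p-3)/2) t)]. Then there exists a unique t̂ > 0 such that S(t̂) = 0, S(t) > 0 for 0 < t < t̂, and S(t) < 0 for t > t̂. -/
/-- `f` is positive on `(0, c)`, vanishes at `c` and is negative on `(c, ∞)`, for some `c > 0`. -/
def PosThenNeg (f : ℝ → ℝ) : Prop :=
  ∃ c : ℝ, 0 < c ∧ f c = 0 ∧ (∀ t, 0 < t → t < c → 0 < f t) ∧ ∀ t, c < t → f t < 0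

theorem PosThenNeg.of_strictAntiOn {f : ℝ → ℝ} {c T : ℝ} (hf : Continuous f) (hc : 0 ≤ c)
    (hanti : StrictAntiOn f (Set.Ici c)) (hfc : 0 < f c)
    (hpos : ∀ t, 0 < t → t ≤ c → 0 < f t) (hT : 0 < T) (hfT : f T ≤ 0) : PosThenNeg f := by
  have hcT : c ≤ T := by
    by_contra! h
    exact (hpos T hT h.le).not_ge hfT
  obtain ⟨z, hz, hfz⟩ := intermediate_value_Icc' hcT hf.continuousOn ⟨hfT, hfc.le⟩
  have hcz : c < z := lt_of_le_of_ne hz.1 (by rintro rfl; exact hfc.ne' hfz)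
  refine ⟨z, hc.trans_lt hcz, hfz, fun t ht htz => ?_, fun t ht => ?_⟩
  · rcases le_total t c with h | h
    · exact hpos t ht h
    · exact hfz ▸ hanti h hz.1 htz
  · exact hfz ▸ hanti hz.1 (hcz.trans ht).le ht

theorem PosThenNeg.of_hasDerivAt {f f' : ℝ → ℝ} {T : ℝ} (hf : ∀ t, HasDerivAt f (f' t) t)
    (hf' : PosThenNeg f') (hf0 : f 0 = 0) (hT : 0 < T) (hfT : f T ≤ 0) : PosThenNeg f := by
  obtain ⟨c, hc, -, hpos, hneg⟩ := hf'
  have hcont : Continuous f := continuous_iff_continuousAt.2 fun t => (hf t).continuousAt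
  have hmono : StrictMonoOn f (Set.Icc 0 c) :=
    strictMonoOn_of_deriv_pos (convex_Icc 0 c) hcont.continuousOn fun t ht => by
      rw [interior_Icc] at ht
      exact (hf t).deriv ▸ hpos t ht.1 ht.2
  have hanti : StrictAntiOn f (Set.Ici c) :=
    strictAntiOn_of_deriv_neg (convex_Ici c) hcont.continuousOn fun t ht => by
      rw [interior_Ici] at ht
      exact (hf t).deriv ▸ hneg t ht
  have hfpos : ∀ t, 0 < t → t ≤ c → 0 < f t := fun t ht htc =>
    hf0 ▸ hmono ⟨le_rfl, hc.le⟩ ⟨ht.le, htc⟩ ht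
  exact .of_strictAntiOn hcont hc.le hanti (hfpos c hc le_rfl) hfpos hT hfT

theorem PosThenNeg.pos_mul {f g : ℝ → ℝ} (hf : PosThenNeg f) (hg : ∀ t, 0 < g t) :
    PosThenNeg fun t => g t * f t := by
  obtain ⟨c, hc, hfc, hpos, hneg⟩ := hf
  exact ⟨c, hc, by simp [hfc], fun t h h' => mul_pos (hg t) (hpos t h h'),
    fun t h => mul_neg_of_pos_of_neg (hg t) (hneg t h)⟩

theorem hasDerivAt_exp_const_mul (k t : ℝ) :
    HasDerivAt (fun t => Real.exp (k * t)) (k * Real.exp (k * t)) t := by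
  simpa [mul_comm] using ((hasDerivAt_id t).const_mul k).exp

theorem exists_pos_lt_mul_exp_two_mul {a : ℝ} (ha : 0 < a) (b : ℝ) :
    ∃ T : ℝ, 0 < T ∧ ∀ t, T ≤ t → b < a * Real.exp (2 * t) := by
  refine ⟨max 1 (b / a), by positivity, fun t ht => ?_⟩
  have h1 : 1 ≤ t := (le_max_left _ _).trans ht
  have h2 : b / a ≤ t := (le_max_right _ _).trans ht
  have h3 := Real.add_one_le_exp (2 * t)
  rw [div_le_iff₀ ha] at h2
  nlinarith

theorem posThenNeg_sub_exp {a b : ℝ} (ha : 0 < a) (hab : a < b) :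
    PosThenNeg fun t => b - a * Real.exp (2 * t) := by
  obtain ⟨T, hT, h⟩ := exists_pos_lt_mul_exp_two_mul ha b
  refine .of_strictAntiOn (c := 0) (by fun_prop) le_rfl (fun x _ y _ hxy => ?_) (by simpa using hab)
    (fun t h h' => absurd h h'.not_gt) hT (by simpa using (h T le_rfl).le)
  have : Real.exp (2 * x) < Real.exp (2 * y) := Real.exp_lt_exp.2 (by linarith)
  simpa using mul_lt_mul_of_pos_left this ha

/-- The factor of the derivative of `16 exp((p+1)t/2) S(t)` that remains after removing
`exp(2t)`. -/
theorem posThenNeg_three_exp {p : ℝ} (hp : 7 < p) :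
    PosThenNeg fun t => (p + 1) * (-(2 * p * (p - 7))) * Real.exp ((p - 1) * t)
      + (p - 1) * ((p + 1) * (2 * p - 4)) * Real.exp ((p - 3) * t)
      - 2 * ((p + 1) * (4 * p + 2)) := by
  have ha : 0 < (p + 1) * (2 * p * (p - 7)) :=
    mul_pos (by linarith) (mul_pos (by linarith) (by linarith))
  obtain ⟨T, hT, h⟩ := exists_pos_lt_mul_exp_two_mul ha ((p - 1) * ((p + 1) * (2 * p - 4)))
  have hsplit (t : ℝ) : Real.exp ((p - 1) * t) = Real.exp ((p - 3) * t) * Real.exp (2 * t) := by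
    rw [← Real.exp_add]; ring_nf
  refine .of_hasDerivAt (fun t => ?_)
    ((posThenNeg_sub_exp ha (b := (p - 3) * ((p + 1) * (2 * p - 4))) (by nlinarith)).pos_mul
      (g := fun t => (p - 1) * Real.exp ((p - 3) * t))
      fun t => mul_pos (by linarith) (Real.exp_pos _))
    (by simp; ring) hT ?_
  · refine ((((hasDerivAt_exp_const_mul (p - 1) t).const_mul _).fun_add
      ((hasDerivAt_exp_const_mul (p - 3) t).const_mul _)).sub_const _).congr_deriv ?_
    rw [hsplit]; ring
  · have := mul_pos (Real.exp_pos ((p - 3) * T)) (sub_pos.2 (h T le_rfl))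
    simp only [hsplit]
    nlinarith

theorem posThenNeg_four_exp {p : ℝ} (hp : 7 < p) :
    PosThenNeg fun t => -(2 * p * (p - 7)) * Real.exp ((p + 1) * t)
      + (p + 1) * (2 * p - 4) * Real.exp ((p - 1) * t)
      - (p + 1) * (4 * p + 2) * Real.exp (2 * t) + (4 * p ^ 2 - 6 * p + 6) := by
  obtain ⟨T₁, hT₁, h₁⟩ := exists_pos_lt_mul_exp_two_mul
    (a := 2 * p * (p - 7)) (mul_pos (by linarith) (by linarith)) ((p + 1) * (2 * p - 4))
  obtain ⟨T₂, -, h₂⟩ := exists_pos_lt_mul_exp_two_mul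
    (a := (p + 1) * (4 * p + 2)) (by nlinarith) (4 * p ^ 2 - 6 * p + 6)
  have hsplit (t : ℝ) : Real.exp ((p + 1) * t) = Real.exp ((p - 1) * t) * Real.exp (2 * t) := by
    rw [← Real.exp_add]; ring_nf
  have hsplit' (t : ℝ) : Real.exp ((p - 1) * t) = Real.exp ((p - 3) * t) * Real.exp (2 * t) := by
    rw [← Real.exp_add]; ring_nf
  refine .of_hasDerivAt (T := max T₁ T₂) (fun t => ?_)
    ((posThenNeg_three_exp hp).pos_mul (g := fun t => Real.exp (2 * t)) fun t => Real.exp_pos _)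
    (by simp; ring) (hT₁.trans_le (le_max_left _ _)) ?_
  · refine (((((hasDerivAt_exp_const_mul (p + 1) t).const_mul _).fun_add
      ((hasDerivAt_exp_const_mul (p - 1) t).const_mul _)).fun_sub
      ((hasDerivAt_exp_const_mul 2 t).const_mul _)).add_const _).congr_deriv ?_
    rw [hsplit, hsplit']; ring
  · have := mul_pos (Real.exp_pos ((p - 1) * max T₁ T₂)) (sub_pos.2 (h₁ _ (le_max_left T₁ T₂)))
    have := h₂ _ (le_max_right T₁ T₂)
    simp only [hsplit]
    nlinarith

/-- For `p > 7`, the function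
`S(t) = (1/8)[(p+3)(p+1)(cosh(((p+1)/2)t) - cosh(((p-3)/2)t))
        - (3p-1)(p-3) sinh(((p+1)/2)t) + (3p-1)(p+1) sinh(((p-3)/2)t)]`
has a unique zero `t̂ > 0`, with `S > 0` on `(0, t̂)` and `S < 0` on `(t̂, ∞)`. -/
theorem S_unique_zero_of_p_gt_seven
    (p : ℝ) (hp : 7 < p)
    (S : ℝ → ℝ)
    (hS : ∀ t : ℝ, S t = 1 / 8 *
      ((p + 3) * (p + 1) * (Real.cosh ((p + 1) / 2 * t) - Real.cosh ((p - 3) / 2 * t))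
        - (3 * p - 1) * (p - 3) * Real.sinh ((p + 1) / 2 * t)
        + (3 * p - 1) * (p + 1) * Real.sinh ((p - 3) / 2 * t))) :
    ∃ that : ℝ, 0 < that ∧ S that = 0 ∧
      (∀ t : ℝ, 0 < t → t < that → 0 < S t) ∧
      (∀ t : ℝ, that < t → S t < 0) ∧
      (∀ t : ℝ, 0 < t → S t = 0 → t = that) := by
  have hfactor (t : ℝ) : S t = 1 / 16 * Real.exp (-((p + 1) / 2 * t)) *
      (-(2 * p * (p - 7)) * Real.exp ((p + 1) * t)
        + (p + 1) * (2 * p - 4) * Real.exp ((p - 1) * t)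
        - (p + 1) * (4 * p + 2) * Real.exp (2 * t) + (4 * p ^ 2 - 6 * p + 6)) := by
    have h₁ : Real.exp ((p + 1) / 2 * t) =
        Real.exp (-((p + 1) / 2 * t)) * Real.exp ((p + 1) * t) := by
      rw [← Real.exp_add]; ring_nf
    have h₂ : Real.exp ((p - 3) / 2 * t) =
        Real.exp (-((p + 1) / 2 * t)) * Real.exp ((p - 1) * t) := by
      rw [← Real.exp_add]; ring_nf
    have h₃ : Real.exp (-((p - 3) / 2 * t)) =
        Real.exp (-((p + 1) / 2 * t)) * Real.exp (2 * t) := by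
      rw [← Real.exp_add]; ring_nf
    rw [hS, Real.cosh_eq, Real.cosh_eq, Real.sinh_eq, Real.sinh_eq, h₁, h₂, h₃]
    ring
  have hPN : PosThenNeg S := by
    rw [funext hfactor]
    exact (posThenNeg_four_exp hp).pos_mul fun t => by positivity
  obtain ⟨c, hc, hSc, hpos, hneg⟩ := hPN
  refine ⟨c, hc, hSc, hpos, hneg, fun t ht hSt => ?_⟩
  rcases lt_trichotomy t c with h | h | h
  · exact absurd hSt (hpos t ht h).ne'
  · exact h
  · exact absurd hSt (hneg t h).ne
end

section
/- For any p > 1, the function f_p(t) = (sinh(p t) - p sinh(t)) / (4 sinh^3((p-1)t/2)) satisfies f_p'(t) - ((p+3)/2) f_p(t) < 0 for all t > 0. -/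
open Real

/-- A function that is nonnegative at `a` and has positive derivative beyond `a` is positive
beyond `a`. -/
lemma pos_of_hasDerivAt_pos {F F' : ℝ → ℝ} {a x : ℝ}
    (hF : ∀ y, a ≤ y → HasDerivAt F (F' y) y) (hpos : ∀ y, a < y → 0 < F' y)
    (ha : 0 ≤ F a) (hx : a < x) : 0 < F x := by
  have hmono : StrictMonoOn F (Set.Ici a) := by
    refine strictMonoOn_of_deriv_pos (convex_Ici a)
      (fun y hy => (hF y hy).continuousAt.continuousWithinAt) fun y hy => ?_
    rw [interior_Ici] at hy
    rw [(hF y (le_of_lt hy)).deriv]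
    exact hpos y hy
  exact ha.trans_lt (hmono Set.self_mem_Ici hx.le hx)

lemma sinh_lt_mul_cosh {x : ℝ} (hx : 0 < x) : sinh x < x * cosh x := by
  have h := pos_of_hasDerivAt_pos (F := fun y => y * cosh y - sinh y)
    (F' := fun y => y * sinh y) (a := 0)
    (fun y _ => by
      have h := ((hasDerivAt_id y).mul (hasDerivAt_cosh y)).sub (hasDerivAt_sinh y)
      refine h.congr_deriv ?_
      simp)
    (fun y hy => mul_pos hy (sinh_pos_iff.2 hy)) (by simp) hx
  linarith

lemma lt_sinh_mul_cosh {x : ℝ} (hx : 0 < x) : x < sinh x * cosh x := by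
  have h1 := self_lt_sinh_iff.2 hx
  nlinarith [one_lt_cosh.2 hx.ne', sinh_pos_iff.2 hx]

lemma sinh_mul_cosh_lt {x : ℝ} (hx : 0 < x) : sinh x * cosh x < 4 * sinh x ^ 2 + x := by
  have h := pos_of_hasDerivAt_pos (F := fun y => 4 * sinh y ^ 2 + y - sinh y * cosh y)
    (F' := fun y => 8 * sinh y * cosh y - 2 * sinh y ^ 2) (a := 0)
    (fun y _ => by
      have h := ((((hasDerivAt_sinh y).pow 2).const_mul 4).add (hasDerivAt_id y)).sub
        ((hasDerivAt_sinh y).mul (hasDerivAt_cosh y))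
      refine h.congr_deriv ?_
      simp
      linarith [cosh_sq y])
    (fun y hy => by
      have := sinh_pos_iff.2 hy
      nlinarith [sinh_lt_cosh y])
    (by simp) hx
  linarith

lemma hasDerivAt_sinh_cube_add (y : ℝ) :
    HasDerivAt (fun y => sinh y ^ 3 + 3 * sinh y - 3 * (y * cosh y))
      (3 * sinh y * (sinh y * cosh y - y)) y := by
  have h := (((hasDerivAt_sinh y).pow 3).add ((hasDerivAt_sinh y).const_mul 3)).sub
    (((hasDerivAt_id y).mul (hasDerivAt_cosh y)).const_mul 3)
  refine h.congr_deriv ?_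
  simp
  ring

lemma three_mul_mul_cosh_lt {x : ℝ} (hx : 0 < x) :
    3 * (x * cosh x) < sinh x ^ 3 + 3 * sinh x := by
  have h := pos_of_hasDerivAt_pos (a := 0) (fun y _ => hasDerivAt_sinh_cube_add y)
    (fun y hy => mul_pos (mul_pos three_pos (sinh_pos_iff.2 hy))
      (sub_pos.2 (lt_sinh_mul_cosh hy))) (by simp) hx
  linarith

lemma sinh_cube_add_lt {x : ℝ} (hx : 0 < x) :
    sinh x ^ 3 + 3 * sinh x - 3 * (x * cosh x) < 2 * (sinh x * (sinh x * cosh x - x)) := by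
  have h := pos_of_hasDerivAt_pos
    (F := fun y => 2 * (sinh y * (sinh y * cosh y - y))
      - (sinh y ^ 3 + 3 * sinh y - 3 * (y * cosh y)))
    (F' := fun y => (sinh y * cosh y - y) * (2 * cosh y - 3 * sinh y) + 4 * sinh y ^ 3) (a := 0)
    (fun y _ => by
      have h := (((hasDerivAt_sinh y).mul (((hasDerivAt_sinh y).mul (hasDerivAt_cosh y)).sub
        (hasDerivAt_id y))).const_mul 2).sub (hasDerivAt_sinh_cube_add y)
      refine h.congr_deriv ?_
      simp
      linear_combination (2 * sinh y) * cosh_sq y)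
    (fun y hy => by
      have hs := sinh_pos_iff.2 hy
      have hu := sub_pos.2 (lt_sinh_mul_cosh hy)
      nlinarith [mul_pos hu (sub_pos.2 (sinh_lt_cosh y)),
        mul_pos hs (sub_pos.2 (sinh_mul_cosh_lt hy))])
    (by simp) hx
  linarith

lemma hasDerivAt_mul_coth {x : ℝ} (hx : 0 < x) :
    HasDerivAt (fun y => y * cosh y / sinh y) ((sinh x * cosh x - x) / sinh x ^ 2) x := by
  have hs := (sinh_pos_iff.2 hx).ne'
  have h := ((hasDerivAt_id x).mul (hasDerivAt_cosh x)).div (hasDerivAt_sinh x) hs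
  refine h.congr_deriv ?_
  simp
  congr 1
  linear_combination (-x) * cosh_sq x

lemma hasDerivAt_deriv_mul_coth {x : ℝ} (hx : 0 < x) :
    HasDerivAt (fun y => (sinh y * cosh y - y) / sinh y ^ 2)
      (2 * (x * cosh x - sinh x) / sinh x ^ 3) x := by
  have hs := (sinh_pos_iff.2 hx).ne'
  have h := (((hasDerivAt_sinh x).mul (hasDerivAt_cosh x)).sub (hasDerivAt_id x)).div
    ((hasDerivAt_sinh x).pow 2) (pow_ne_zero 2 hs)
  refine h.congr_deriv ?_
  simp
  field_simp
  linear_combination (-sinh x) * cosh_sq x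

/-- The key inequality, in terms of the function `x ↦ x coth x`. -/
lemma sq_sub_sq_lt_mul_coth {a b : ℝ} (ha : 0 < a) (hab : a < b) :
    b ^ 2 - a ^ 2 < (b * cosh b / sinh b - a * cosh a / sinh a)
      * (3 * (a * cosh a / sinh a) + 2 * b - a) := by
  have hsa := sinh_pos_iff.2 ha
  have hg : 1 < a * cosh a / sinh a := by
    rw [one_lt_div hsa]; exact sinh_lt_mul_cosh ha
  set k := a * cosh a / sinh a with hk
  have hD' : ∀ y, a < y → 0 < (sinh y * cosh y - y) / sinh y ^ 2 * (3 * k + 2 * y - a)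
      + 2 * (y * cosh y / sinh y - k) - 2 * y := by
    intro x hx
    refine pos_of_hasDerivAt_pos
      (F := fun y => (sinh y * cosh y - y) / sinh y ^ 2 * (3 * k + 2 * y - a)
        + 2 * (y * cosh y / sinh y - k) - 2 * y)
      (F' := fun y => 2 * (y * cosh y - sinh y) / sinh y ^ 3 * (3 * k + 2 * y - a)
        + 4 * ((sinh y * cosh y - y) / sinh y ^ 2) - 2) (a := a) ?_ ?_ ?_ hx
    · intro y hy
      have hy0 := ha.trans_le hy
      have h := (((hasDerivAt_deriv_mul_coth hy0).mul
        ((((hasDerivAt_id y).const_mul 2).const_add (3 * k)).sub_const a)).add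
        (((hasDerivAt_mul_coth hy0).sub_const k).const_mul 2)).sub
        ((hasDerivAt_id y).const_mul 2)
      refine h.congr_deriv ?_
      simp
      ring
    · intro y hy
      have hy0 := ha.trans hy
      have hs := sinh_pos_iff.2 hy0
      have h2 : 0 < 2 * (y * cosh y - sinh y) / sinh y ^ 3 :=
        div_pos (by linarith [sinh_lt_mul_cosh hy0]) (by positivity)
      have h3 : 0 < 2 * (y * cosh y - sinh y) / sinh y ^ 3 * 3
          + 4 * ((sinh y * cosh y - y) / sinh y ^ 2) - 2 := by
        have : 2 * (y * cosh y - sinh y) / sinh y ^ 3 * 3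
          + 4 * ((sinh y * cosh y - y) / sinh y ^ 2) - 2
          = 2 * (2 * (sinh y * (sinh y * cosh y - y))
            - (sinh y ^ 3 + 3 * sinh y - 3 * (y * cosh y))) / sinh y ^ 3 := by
          field_simp
          ring
        rw [this]
        exact div_pos (by linarith [sinh_cube_add_lt hy0]) (by positivity)
      nlinarith [mul_pos h2 (by linarith : 0 < 3 * k + 2 * y - a - 3)]
    · have : (sinh a * cosh a - a) / sinh a ^ 2 * (3 * k + 2 * a - a)
          + 2 * (a * cosh a / sinh a - k) - 2 * a
          = a * ((sinh a ^ 3 + 3 * sinh a - 3 * (a * cosh a))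
            + sinh a * (sinh a * cosh a - a)) / sinh a ^ 3 := by
        rw [hk]
        field_simp
        linear_combination (3 * sinh a) * cosh_sq a
      simp only [this]
      have h1 := three_mul_mul_cosh_lt ha
      have h2 := mul_pos hsa (sub_pos.2 (lt_sinh_mul_cosh ha))
      exact div_nonneg (mul_nonneg ha.le (by linarith)) (by positivity)
  have h := pos_of_hasDerivAt_pos
    (F := fun y => (y * cosh y / sinh y - k) * (3 * k + 2 * y - a) - (y ^ 2 - a ^ 2))
    (F' := fun y => (sinh y * cosh y - y) / sinh y ^ 2 * (3 * k + 2 * y - a)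
      + 2 * (y * cosh y / sinh y - k) - 2 * y) (a := a) (fun y hy => by
      have hy0 := ha.trans_le hy
      have h := (((hasDerivAt_mul_coth hy0).sub_const k).mul
        ((((hasDerivAt_id y).const_mul 2).const_add (3 * k)).sub_const a)).sub
        (((hasDerivAt_id y).pow 2).sub_const (a ^ 2))
      refine h.congr_deriv ?_
      simp
      ring)
    hD' (by simp [hk]) hab
  linarith

/-- For any `p > 1`, the function
`f_p(t) = (sinh(pt) - p sinh t)/(4 sinh³((p-1)t/2))` satisfies
`f_p'(t) - ((p+3)/2) f_p(t) < 0` for all `t > 0`. -/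
theorem fp_deriv_sub_neg
    (p : ℝ) (hp : 1 < p)
    (f : ℝ → ℝ)
    (hf : ∀ t : ℝ, f t = (Real.sinh (p * t) - p * Real.sinh t)
      / (4 * (Real.sinh ((p - 1) / 2 * t)) ^ 3)) :
    ∀ t : ℝ, 0 < t → deriv f t - (p + 3) / 2 * f t < 0 := by
  intro t ht
  set A := (p - 1) / 2 * t with hA
  set B := (p + 1) / 2 * t with hB
  have hA0 : 0 < A := mul_pos (by linarith) ht
  have hAB : A < B := by rw [hA, hB]; nlinarith
  have hS := sinh_pos_iff.2 hA0
  have hT := sinh_pos_iff.2 (hA0.trans hAB)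
  have hpt : p * t = B + A := by rw [hA, hB]; ring
  have ht' : t = B - A := by rw [hA, hB]; ring
  have hsp : sinh (p * t) = sinh B * cosh A + cosh B * sinh A := by rw [hpt, sinh_add]
  have hs1 : sinh t = sinh B * cosh A - cosh B * sinh A := by
    rw [← sinh_sub, ← ht']
  have hcp : cosh (p * t) = cosh B * cosh A + sinh B * sinh A := by rw [hpt, cosh_add]
  have hc1 : cosh t = cosh B * cosh A - sinh B * sinh A := by
    rw [← cosh_sub, ← ht']
  have hlin (c : ℝ) : HasDerivAt (fun y => c * y) c t := by
    simpa using (hasDerivAt_id t).const_mul c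
  have hder : HasDerivAt f
      (((cosh (p * t) * p - p * cosh t) * (4 * sinh A ^ 3)
        - (sinh (p * t) - p * sinh t) * (4 * (3 * sinh A ^ 2 * (cosh A * ((p - 1) / 2)))))
        / (4 * sinh A ^ 3) ^ 2) t := by
    rw [funext hf]
    have h := ((hlin p).sinh.sub ((hasDerivAt_sinh t).const_mul p)).div
      ((((hlin ((p - 1) / 2)).sinh).pow 3).const_mul 4)
      (mul_pos four_pos (pow_pos hS 3)).ne'
    refine h.congr_deriv ?_
    simp [hA]
  have key := sq_sub_sq_lt_mul_coth hA0 hAB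
  have hpoly : t ^ 2 * p * (sinh A ^ 2 * sinh B) < t ^ 2 *
      (((p + 1) / 2 * cosh B * sinh A - (p - 1) / 2 * cosh A * sinh B)
        * (3 * ((p - 1) / 2) * cosh A + (p + 3) / 2 * sinh A)) := by
    have h := mul_lt_mul_of_pos_right key (by positivity : 0 < sinh A ^ 2 * sinh B)
    have e1 : (B ^ 2 - A ^ 2) = t ^ 2 * p := by rw [hA, hB]; ring
    have e2 : (B * cosh B / sinh B - A * cosh A / sinh A)
        * (3 * (A * cosh A / sinh A) + 2 * B - A) * (sinh A ^ 2 * sinh B)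
        = (B * cosh B * sinh A - A * cosh A * sinh B)
          * (3 * A * cosh A + (2 * B - A) * sinh A) := by
      field_simp
      ring
    rw [e1, e2] at h
    refine h.trans_eq ?_
    generalize cosh A = a, cosh B = b, sinh A = c, sinh B = d
    rw [hA, hB]
    ring
  have hpoly' := lt_of_mul_lt_mul_left (by rwa [mul_assoc] at hpoly) (sq_nonneg t)
  rw [hder.deriv, hf t, ← hA, hsp, hs1, hcp, hc1]
  have e : ((cosh B * cosh A + sinh B * sinh A) * p - p * (cosh B * cosh A - sinh B * sinh A))
        * (4 * sinh A ^ 3)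
        - (sinh B * cosh A + cosh B * sinh A - p * (sinh B * cosh A - cosh B * sinh A))
          * (4 * (3 * sinh A ^ 2 * (cosh A * ((p - 1) / 2))))
      = (4 * sinh A ^ 2) * (2 * p * (sinh A ^ 2 * sinh B)
        - 2 * ((p + 1) / 2 * cosh B * sinh A - (p - 1) / 2 * cosh A * sinh B)
          * (3 * ((p - 1) / 2) * cosh A)) := by ring
  have e' : (((cosh B * cosh A + sinh B * sinh A) * p
        - p * (cosh B * cosh A - sinh B * sinh A)) * (4 * sinh A ^ 3)
        - (sinh B * cosh A + cosh B * sinh A - p * (sinh B * cosh A - cosh B * sinh A))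
          * (4 * (3 * sinh A ^ 2 * (cosh A * ((p - 1) / 2))))) / (4 * sinh A ^ 3) ^ 2
      - (p + 3) / 2 * ((sinh B * cosh A + cosh B * sinh A
        - p * (sinh B * cosh A - cosh B * sinh A)) / (4 * sinh A ^ 3))
      = (p * (sinh A ^ 2 * sinh B)
        - ((p + 1) / 2 * cosh B * sinh A - (p - 1) / 2 * cosh A * sinh B)
        * (3 * ((p - 1) / 2) * cosh A + (p + 3) / 2 * sinh A)) / (2 * sinh A ^ 4) := by
    rw [e]
    field_simp
    ring
  rw [e']
  exact div_neg_of_neg_of_pos (by linarith) (by positivity)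
end

section
/- Let 1 < p < 3 and define T(t) = ((p+1)(p+3)/8)(cosh(((p-3)/2) t) - cosh(((p+1)/2) t)) + ((3p-1)(p+1)/8) sinh(((p-3)/2) t) - ((p-3)(3p-1)/8) sinh(((p+1)/2) t). Then T(t) < 0 and T is strictly decreasing for all t > 0. -/
/-- With `d = (p - 1) / 2`, this is the negativity of the derivative of `T` after the frequencies
`(3 - p) / 2 = 1 - d` and `(p + 1) / 2 = 1 + d` are split by the addition formulas. -/
lemma mul_sinh_mul_sinh_lt {d t : ℝ} (hd : 0 < d) (ht : 0 < t) :
    (1 + 3 * d) * (1 - d) * (Real.sinh t * Real.sinh (d * t)) <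
      (2 + d) * (Real.cosh t * Real.sinh (d * t) + d * (Real.sinh t * Real.cosh (d * t))) := by
  have hS : 0 < Real.sinh t := Real.sinh_pos_iff.2 ht
  have hs : 0 < Real.sinh (d * t) := Real.sinh_pos_iff.2 (by positivity)
  have h₁ : Real.sinh t * Real.sinh (d * t) < Real.cosh t * Real.sinh (d * t) :=
    mul_lt_mul_of_pos_right (Real.sinh_lt_cosh t) hs
  have h₂ : Real.sinh t * Real.sinh (d * t) < Real.sinh t * Real.cosh (d * t) :=
    mul_lt_mul_of_pos_left (Real.sinh_lt_cosh _) hS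
  calc (1 + 3 * d) * (1 - d) * (Real.sinh t * Real.sinh (d * t))
      < (2 + d) * (1 + d) * (Real.sinh t * Real.sinh (d * t)) :=
        mul_lt_mul_of_pos_right (by nlinarith) (mul_pos hS hs)
    _ = (2 + d) * (Real.sinh t * Real.sinh (d * t)
          + d * (Real.sinh t * Real.sinh (d * t))) := by ring
    _ < _ := by gcongr

/-- For `1 < p < 3`, the function
`T(t) = ((p+1)(p+3)/8)(cosh(((p-3)/2)t) - cosh(((p+1)/2)t))
        + ((3p-1)(p+1)/8) sinh(((p-3)/2)t) - ((p-3)(3p-1)/8) sinh(((p+1)/2)t)`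
is strictly negative and strictly decreasing on `(0, ∞)`. -/
theorem T_neg_and_strictAnti
    (p : ℝ) (hp₁ : 1 < p) (hp₃ : p < 3)
    (T : ℝ → ℝ)
    (hT : ∀ t : ℝ, T t =
      (p + 1) * (p + 3) / 8 * (Real.cosh ((p - 3) / 2 * t) - Real.cosh ((p + 1) / 2 * t))
        + (3 * p - 1) * (p + 1) / 8 * Real.sinh ((p - 3) / 2 * t)
        - (p - 3) * (3 * p - 1) / 8 * Real.sinh ((p + 1) / 2 * t)) :
    (∀ t : ℝ, 0 < t → T t < 0) ∧ StrictAntiOn T (Set.Ioi 0) := by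
  have hderiv : ∀ t : ℝ, HasDerivAt T
      ((p + 1) * (p + 3) / 8 * (Real.sinh ((p - 3) / 2 * t) * ((p - 3) / 2)
          - Real.sinh ((p + 1) / 2 * t) * ((p + 1) / 2))
        + (3 * p - 1) * (p + 1) / 8 * (Real.cosh ((p - 3) / 2 * t) * ((p - 3) / 2))
        - (p - 3) * (3 * p - 1) / 8 * (Real.cosh ((p + 1) / 2 * t) * ((p + 1) / 2))) t := by
    intro t
    rw [funext hT]
    have hlin (c : ℝ) : HasDerivAt (fun t : ℝ => c * t) c t := by
      simpa using (hasDerivAt_id t).const_mul c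
    exact ((((hlin _).cosh.sub (hlin _).cosh).const_mul _).add
      ((hlin _).sinh.const_mul _)).sub ((hlin _).sinh.const_mul _)
  have hanti : StrictAntiOn T (Set.Ici 0) := by
    refine strictAntiOn_of_deriv_neg (convex_Ici 0)
      (fun t _ => (hderiv t).continuousAt.continuousWithinAt) fun t ht => ?_
    rw [interior_Ici, Set.mem_Ioi] at ht
    obtain ⟨d, rfl⟩ : ∃ d, p = 1 + 2 * d := ⟨(p - 1) / 2, by ring⟩
    have hd : 0 < d := by linarith
    rw [(hderiv t).deriv,
      show (1 + 2 * d - 3) / 2 * t = d * t - t by ring,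
      show (1 + 2 * d + 1) / 2 * t = d * t + t by ring,
      Real.sinh_sub, Real.cosh_sub, Real.sinh_add, Real.cosh_add]
    have key := mul_pos (show 0 < 1 + d by linarith) (sub_pos.2 (mul_sinh_mul_sinh_lt hd ht))
    linarith
  have hT₀ : T 0 = 0 := by simp [hT]
  exact ⟨fun t ht => hT₀ ▸ hanti Set.self_mem_Ici ht.le ht, hanti.mono Set.Ioi_subset_Ici_self⟩
end
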